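/- arXiv:1305.5365 — 3 statements merged into one kernel-verified Lean document; each statement's English description precedes it below -/
import Mathlib

section
/- Let (T(t))_{t≥0} be a bounded C₀-semigroup on a complex Banach space X with generator −A. Assume that σ(A) ∩ iℝ = {0} and that lim_{s→0} max( ‖s(is+A)^{-1}‖, ‖s(−is+A)^{-1}‖ ) = ∞. Let m(s) = sup{ ‖(ir+A)^{-1}‖ : |r| ≥ s } for s > 0, and let m^{-1} be any right inverse of m. Then there exist constants c > 0 and c' > 0 such that ‖T(t)A(I+A)^{-1}‖ ≥ c · m^{-1}(c't) for all sufficiently large t. -/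
open Filter MeasureTheory Set Complex Asymptotics

noncomputable section

/-- A `C₀`-semigroup of bounded linear operators on `X`:  a strongly continuous family
`(T t)_{t ≥ 0}` with `T 0 = 1` and `T (s+t) = T s ∘ T t`. -/
structure C0Semigroup (X : Type*) [NormedAddCommGroup X] [NormedSpace ℂ X] where
  T : ℝ → X →L[ℂ] X
  map_zero : T 0 = 1
  map_add : ∀ s t : ℝ, 0 ≤ s → 0 ≤ t → T (s + t) = T s ∘L T t
  strong_continuity : ∀ x : X, ContinuousOn (fun t : ℝ => T t x) (Set.Ici 0)

/-- A `C₀`-semigroup is bounded if `sup_{t ≥ 0} ‖T t‖ < ∞`. -/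
def C0Semigroup.Bounded {X : Type*} [NormedAddCommGroup X] [NormedSpace ℂ X]
    (Tsg : C0Semigroup X) : Prop :=
  ∃ K : ℝ, ∀ t : ℝ, 0 ≤ t → ‖Tsg.T t‖ ≤ K

/-- `R` is the bounded inverse `(lam + A)⁻¹` of `lam + A`, where `A` is a partially
defined linear operator on `X`. -/
structure IsResolvent {X : Type*} [NormedAddCommGroup X] [NormedSpace ℂ X]
    (A : X →ₗ.[ℂ] X) (lam : ℂ) (R : X →L[ℂ] X) : Prop where
  mem_domain : ∀ x : X, R x ∈ A.domain
  eq_apply : ∀ x : X, lam • R x + A ⟨R x, mem_domain x⟩ = x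
  left_inv : ∀ x : A.domain, R (lam • (x : X) + A x) = x

/-- `-A` is the generator of the `C₀`-semigroup `Tsg`:  the domain of `A` is exactly the
set of points `x` for which the right derivative of the orbit `t ↦ T t x` exists at `0`,
and there `A x` equals minus that derivative. -/
def IsGenerator {X : Type*} [NormedAddCommGroup X] [NormedSpace ℂ X]
    (Tsg : C0Semigroup X) (A : X →ₗ.[ℂ] X) : Prop :=
  ∀ x y : X,
    (∃ hx : x ∈ A.domain, A ⟨x, hx⟩ = y) ↔
      Filter.Tendsto (fun t : ℝ => (t : ℂ)⁻¹ • (Tsg.T t x - x))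
        (nhdsWithin 0 (Set.Ioi 0)) (nhds (-y))

/-- A positive measurable function `l` is slowly varying if `l (lam * s) / l s → 1`
as `s → ∞`, for every `lam > 0`. -/
def SlowlyVarying (l : ℝ → ℝ) : Prop :=
  Measurable l ∧ (∀ᶠ s in atTop, 0 < l s) ∧
    ∀ lam : ℝ, 0 < lam → Tendsto (fun s : ℝ => l (lam * s) / l s) atTop (nhds 1)

/-- `ls` is a de Bruijn conjugate of the slowly varying function `l`. -/
def IsDeBruijnConjugate (l ls : ℝ → ℝ) : Prop :=
  SlowlyVarying ls ∧
    Tendsto (fun s : ℝ => l s * ls (s * l s)) atTop (nhds 1) ∧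
    Tendsto (fun s : ℝ => ls s * l (s * ls s)) atTop (nhds 1)

/-- A monotonic slowly varying function `l` is dB-symmetric when `1 / l` is a
de Bruijn conjugate of `l`. -/
def DBSymmetric (l : ℝ → ℝ) : Prop := IsDeBruijnConjugate l fun s => (l s)⁻¹

/-- `g` is an asymptotic inverse of `f`:  `g (f s) ∼ s` and `f (g s) ∼ s` as `s → ∞`. -/
def IsAsympInverse (g f : ℝ → ℝ) : Prop :=
  Tendsto (fun s : ℝ => g (f s) / s) atTop (nhds 1) ∧
    Tendsto (fun s : ℝ => f (g s) / s) atTop (nhds 1)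

/-- The Balakrishnan integral defining the fractional power `B ^ γ` (`0 < γ < 1`) of a
bounded sectorial operator `B`. -/
def balakrishnan {X : Type*} [NormedAddCommGroup X] [NormedSpace ℂ X] [CompleteSpace X]
    (B : X →L[ℂ] X) (γ : ℝ) : X →L[ℂ] X :=
  (Real.sin (Real.pi * γ) / Real.pi) •
    ∫ t in Set.Ioi (0 : ℝ),
      (t ^ (γ - 1) : ℝ) • (B * Ring.inverse ((t : ℂ) • (1 : X →L[ℂ] X) + B))

/-- The fractional power `B ^ α`, `α ≥ 0`, of a bounded sectorial operator `B`, obtained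
from integer powers and the Balakrishnan formula for the fractional part. -/
def opPow {X : Type*} [NormedAddCommGroup X] [NormedSpace ℂ X] [CompleteSpace X]
    (B : X →L[ℂ] X) (α : ℝ) : X →L[ℂ] X :=
  if α = (⌊α⌋₊ : ℝ) then B ^ (⌊α⌋₊ : ℕ) else B ^ (⌊α⌋₊ : ℕ) * balakrishnan B (α - ⌊α⌋₊)

end

theorem orbit_deriv_right {X : Type*} [NormedAddCommGroup X] [NormedSpace ℂ X]
    (Tsg : C0Semigroup X) (A : X →ₗ.[ℂ] X) (hgen : IsGenerator Tsg A)
    (y : A.domain) (t : ℝ) (ht : 0 ≤ t) :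
    HasDerivWithinAt (fun u : ℝ => Tsg.T u (y : X)) (Tsg.T t (-(A y))) (Set.Ici t) t := by
  have h := (hgen (y : X) (A y)).1 ⟨y.2, rfl⟩
  rw [← hasDerivWithinAt_Ioi_iff_Ici, hasDerivWithinAt_iff_tendsto_slope' (by simp)]
  have h2 : Tendsto (fun u : ℝ => u - t) (nhdsWithin t (Set.Ioi t))
      (nhdsWithin 0 (Set.Ioi 0)) := by
    apply tendsto_nhdsWithin_of_tendsto_nhds_of_eventually_within
    · have : Tendsto (fun u : ℝ => u - t) (nhds t) (nhds (t - t)) :=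
        (continuous_id.sub continuous_const).tendsto t
      rw [sub_self] at this
      exact this.mono_left nhdsWithin_le_nhds
    · filter_upwards [self_mem_nhdsWithin] with u hu
      simpa using hu
  have h3 := ((Tsg.T t).continuous.tendsto _).comp (h.comp h2)
  refine h3.congr' ?_
  filter_upwards [self_mem_nhdsWithin] with u hu
  have hu' : t < u := hu
  have e : Tsg.T u = Tsg.T t ∘L Tsg.T (u - t) := by
    rw [← Tsg.map_add t (u - t) ht (by linarith)]
    congr 1; ring
  simp only [Function.comp, slope, vsub_eq_sub, map_smul, map_sub]
  rw [e, ← Complex.ofReal_inv, Complex.coe_smul]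
  rfl

theorem resolvent_ode_bound {X : Type*} [NormedAddCommGroup X] [NormedSpace ℂ X]
    (Tsg : C0Semigroup X) (A : X →ₗ.[ℂ] X) (hgen : IsGenerator Tsg A)
    (K : ℝ) (hK : ∀ t : ℝ, 0 ≤ t → ‖Tsg.T t‖ ≤ K)
    (y : A.domain) (x : X) (s : ℝ) (hx : (Complex.I * (s : ℂ)) • (y : X) + A y = x)
    (t : ℝ) (ht : 0 ≤ t) :
    ‖(y : X)‖ ≤ ‖Tsg.T t (y : X)‖ + K * t * ‖x‖ := by
  have hn : ∀ u : ℝ, ‖Complex.exp ((u : ℂ) * (-(Complex.I * (s : ℂ))))‖ = 1 := by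
    intro u
    have : (u : ℂ) * (-(Complex.I * (s : ℂ))) = ((-(u * s) : ℝ) : ℂ) * Complex.I := by
      push_cast; ring
    rw [this, Complex.norm_exp_ofReal_mul_I]
  have hd : ∀ u ∈ Set.Ico (0 : ℝ) t, HasDerivWithinAt
      (fun u : ℝ => Complex.exp ((u : ℂ) * (-(Complex.I * (s : ℂ)))) • Tsg.T u (y : X))
      (-(Complex.exp ((u : ℂ) * (-(Complex.I * (s : ℂ)))) • Tsg.T u x)) (Set.Ici u) u := by
    intro u hu
    have h1 := orbit_deriv_right Tsg A hgen y u hu.1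
    have h2 : HasDerivAt (fun u : ℝ => Complex.exp ((u : ℂ) * (-(Complex.I * (s : ℂ)))))
        (Complex.exp ((u : ℂ) * (-(Complex.I * (s : ℂ)))) * (1 * (-(Complex.I * (s : ℂ))))) u :=
      ((Complex.ofRealCLM.hasDerivAt (x := u)).mul_const _).cexp
    have h3 := h2.hasDerivWithinAt (s := Set.Ici u) |>.smul h1
    refine h3.congr_deriv ?_
    rw [← hx]
    simp only [map_add, map_smul, map_neg, smul_add, smul_neg, smul_smul, neg_add, one_mul,
      mul_neg, neg_smul]
    abel
  have key := norm_image_sub_le_of_norm_deriv_right_le_segment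
    (f := fun u : ℝ => Complex.exp ((u : ℂ) * (-(Complex.I * (s : ℂ)))) • Tsg.T u (y : X))
    (a := 0) (b := t) (C := K * ‖x‖) ?_ hd ?_ t ⟨ht, le_rfl⟩
  · have e0 : Tsg.T 0 (y : X) = y := by rw [Tsg.map_zero]; rfl
    simp only [Complex.ofReal_zero, zero_mul, Complex.exp_zero, one_smul, e0, sub_zero] at key
    have h4 : ‖Complex.exp ((t : ℂ) * (-(Complex.I * (s : ℂ)))) • Tsg.T t (y : X)‖
        = ‖Tsg.T t (y : X)‖ := by rw [norm_smul, hn, one_mul]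
    have h5 := norm_sub_norm_le (y : X)
      (Complex.exp ((t : ℂ) * (-(Complex.I * (s : ℂ)))) • Tsg.T t (y : X))
    rw [norm_sub_rev] at key
    rw [h4] at h5
    nlinarith
  · apply ContinuousOn.smul
    · fun_prop
    · exact (Tsg.strong_continuity _).mono Set.Icc_subset_Ici_self
  · intro u hu
    rw [norm_neg, norm_smul, hn, one_mul]
    exact (Tsg.T u).le_of_opNorm_le (hK u hu.1) x

theorem resolvent_bound {X : Type*} [NormedAddCommGroup X] [NormedSpace ℂ X]
    (Tsg : C0Semigroup X) (A : X →ₗ.[ℂ] X) (hgen : IsGenerator Tsg A)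
    (K : ℝ) (hK : ∀ t : ℝ, 0 ≤ t → ‖Tsg.T t‖ ≤ K)
    (J : X →L[ℂ] X) (hJ : IsResolvent A 1 J) (r s : ℝ) (R : X →L[ℂ] X)
    (hR : IsResolvent A (Complex.I * (r : ℂ)) R) (t : ℝ) (ht : 0 ≤ t)
    (hs : 0 < s) (hs1 : s ≤ 1) (hr : s ≤ |r|)
    (hN : 4 * ‖Tsg.T t ∘L ((1 : X →L[ℂ] X) - J)‖ ≤ s) :
    ‖R‖ ≤ 2 * K * t + 2 * (K + 1) / s := by
  have hK0 : 0 ≤ K := (norm_nonneg _).trans (hK 0 le_rfl)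
  refine R.opNorm_le_bound (by positivity) fun x => ?_
  set y : A.domain := ⟨R x, hR.mem_domain x⟩ with hy
  have hx : (Complex.I * (r : ℂ)) • (y : X) + A y = x := hR.eq_apply x
  have h1 := resolvent_ode_bound Tsg A hgen K hK y x r hx t ht
  have hAy : A y = x - (Complex.I * (r : ℂ)) • (y : X) := by rw [← hx]; abel
  have hJy : J ((y : X) + A y) = y := by simpa using hJ.left_inv y
  set N := ‖Tsg.T t ∘L ((1 : X →L[ℂ] X) - J)‖ with hNdef
  have hN0 : 0 ≤ N := norm_nonneg _
  have e1 : (Complex.I * (r : ℂ)) • Tsg.T t (y : X) =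
      Tsg.T t x - (Tsg.T t ∘L ((1 : X →L[ℂ] X) - J)) ((y : X) + A y) := by
    have : ((1 : X →L[ℂ] X) - J) ((y : X) + A y) = A y := by
      simp [hJy]
    rw [ContinuousLinearMap.comp_apply, this, hAy]
    simp
  have n1 : |r| * ‖Tsg.T t (y : X)‖ ≤ K * ‖x‖ + N * (‖(y : X)‖ + (‖x‖ + |r| * ‖(y : X)‖)) := by
    have : |r| * ‖Tsg.T t (y : X)‖ = ‖(Complex.I * (r : ℂ)) • Tsg.T t (y : X)‖ := by
      simp [norm_smul]
    rw [this, e1]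
    refine (norm_sub_le _ _).trans (add_le_add ((Tsg.T t).le_of_opNorm_le (hK t ht) x) ?_)
    refine (ContinuousLinearMap.le_opNorm _ _).trans ?_
    refine mul_le_mul_of_nonneg_left ?_ hN0
    refine (norm_add_le _ _).trans (add_le_add le_rfl ?_)
    rw [hAy]
    refine (norm_sub_le _ _).trans ?_
    simp [norm_smul]
  change ‖(y : X)‖ ≤ _
  set a := ‖(y : X)‖
  set b := ‖Tsg.T t (y : X)‖
  set z := ‖x‖
  have ha : 0 ≤ a := norm_nonneg _
  have hz : 0 ≤ z := norm_nonneg _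
  have hr0 : 0 < |r| := hs.trans_le hr
  have n2 : b ≤ (K + 1) / s * z + a / 2 := by
    have : |r| * b ≤ |r| * ((K + 1) / s * z + a / 2) := by
      refine n1.trans ?_
      have i1 : (K + 1) * z ≤ |r| * ((K + 1) / s * z) := by
        have : |r| * ((K + 1) / s * z) = (|r| / s) * ((K + 1) * z) := by ring
        rw [this]
        have h1 : 1 ≤ |r| / s := by rwa [one_le_div hs]
        nlinarith [show 0 ≤ (K + 1) * z by positivity]
      have i2 : N * a ≤ |r| / 4 * a := mul_le_mul_of_nonneg_right (by linarith) ha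
      have i3 : N * z ≤ 1 * z := mul_le_mul_of_nonneg_right (by linarith) hz
      have i4 : N * (|r| * a) ≤ 1 / 4 * (|r| * a) :=
        mul_le_mul_of_nonneg_right (by linarith) (by positivity)
      linarith
    exact le_of_mul_le_mul_left this hr0
  have : (2 * K * t + 2 * (K + 1) / s) * z = 2 * (K * t * z) + 2 * ((K + 1) / s * z) := by ring
  linarith


/-- lower bound for decay, singularity at zero.  Let `(T(t))_{t≥0}` be
a bounded `C₀`-semigroup on a complex Banach space `X` with generator `−A`, with
`σ(A) ∩ iℝ = {0}` and `max(‖s(is+A)⁻¹‖, ‖s(−is+A)⁻¹‖) → ∞` as `s → 0`.  Let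
`m(s) = sup{‖(ir+A)⁻¹‖ : |r| ≥ s}` for `s > 0` and let `m⁻¹` be a right inverse of `m`.
Then there are `c, c' > 0` with `‖T(t)A(I+A)⁻¹‖ ≥ c·m⁻¹(c't)` for all large `t`. -/
theorem lower_bound_decay_singularity_at_zero
    {X : Type*} [NormedAddCommGroup X] [NormedSpace ℂ X] [CompleteSpace X]
    (Tsg : C0Semigroup X) (hbdd : Tsg.Bounded)
    (A : X →ₗ.[ℂ] X) (hgen : IsGenerator Tsg A)
    (h0 : ¬ ∃ R : X →L[ℂ] X, IsResolvent A 0 R)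
    (Res : ℝ → X →L[ℂ] X)
    (hRes : ∀ s : ℝ, s ≠ 0 → IsResolvent A (Complex.I * (s : ℂ)) (Res s))
    (J : X →L[ℂ] X) (hJ : IsResolvent A 1 J)
    (hblow : Tendsto (fun s : ℝ => max (|s| * ‖Res s‖) (|s| * ‖Res (-s)‖))
      (nhdsWithin 0 {(0 : ℝ)}ᶜ) atTop)
    (m : ℝ → ℝ)
    (hm : ∀ s : ℝ, 0 < s → IsLUB {y : ℝ | ∃ r : ℝ, s ≤ |r| ∧ y = ‖Res r‖} (m s))
    (minv : ℝ → ℝ)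
    (hminv : ∃ a : ℝ, ∀ t : ℝ, a ≤ t → 0 < minv t ∧ m (minv t) = t) :
    ∃ c > (0 : ℝ), ∃ c' > (0 : ℝ), ∃ t₀ : ℝ, ∀ t : ℝ, t₀ ≤ t →
      c * minv (c' * t) ≤ ‖Tsg.T t ∘L ((1 : X →L[ℂ] X) - J)‖ := by
  obtain ⟨K, hK⟩ := hbdd
  have hK0 : 0 ≤ K := (norm_nonneg _).trans (hK 0 le_rfl)
  obtain ⟨a, ha⟩ := hminv
  have hev := hblow.eventually_ge_atTop (4 * (K + 1))
  rw [eventually_nhdsWithin_iff, Metric.eventually_nhds_iff] at hev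
  obtain ⟨ε, hε, hev⟩ := hev
  have hms : ∀ s : ℝ, 0 < s → s < ε → 4 * (K + 1) ≤ s * m s := by
    intro s hs hsε
    have h1 := hev (y := s) (by simpa [abs_of_pos hs] using hsε) (by simpa using hs.ne')
    have u1 : ‖Res s‖ ≤ m s := (hm s hs).1 ⟨s, le_abs_self s, rfl⟩
    have u2 : ‖Res (-s)‖ ≤ m s := (hm s hs).1 ⟨-s, by rw [abs_neg]; exact le_abs_self s, rfl⟩
    rw [abs_of_pos hs] at h1
    refine h1.trans (max_le ?_ ?_)
    · exact mul_le_mul_of_nonneg_left u1 hs.le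
    · exact mul_le_mul_of_nonneg_left u2 hs.le
  set s0 : ℝ := min (ε / 2) 1 with hs0
  have hs0p : 0 < s0 := lt_min (by linarith) one_pos
  have hmanti : ∀ s s' : ℝ, 0 < s → s ≤ s' → m s' ≤ m s := by
    intro s s' hs hss
    refine (hm s' (hs.trans_le hss)).2 ?_
    rintro y ⟨r, hr, rfl⟩
    exact (hm s hs).1 ⟨r, hss.trans hr, rfl⟩
  refine ⟨1 / 4, by norm_num, 4 * K + 1, by positivity, max 1 (max a (m s0 + 1)), ?_⟩
  intro t ht
  have ht1 : 1 ≤ t := (le_max_left _ _).trans ht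
  have hta : a ≤ t := ((le_max_left _ _).trans (le_max_right _ _)).trans ht
  have htm : m s0 + 1 ≤ t := ((le_max_right _ _).trans (le_max_right _ _)).trans ht
  have htc : t ≤ (4 * K + 1) * t := by nlinarith
  obtain ⟨hs, hms'⟩ := ha _ (hta.trans htc)
  set s := minv ((4 * K + 1) * t)
  have hss0 : s < s0 := by
    by_contra hcon
    have := hmanti s0 s hs0p (not_lt.1 hcon)
    linarith
  by_contra hcon
  have hN : 4 * ‖Tsg.T t ∘L ((1 : X →L[ℂ] X) - J)‖ ≤ s := by linarith
  have hs1 : s ≤ 1 := hss0.le.trans (min_le_right _ _)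
  have hsε : s < ε := by
    have : s0 ≤ ε / 2 := min_le_left _ _
    linarith
  have hle : m s ≤ 2 * K * t + 2 * (K + 1) / s := by
    refine (hm s hs).2 ?_
    rintro y ⟨r, hr, rfl⟩
    have hr0 : r ≠ 0 := abs_pos.1 (hs.trans_le hr)
    exact resolvent_bound Tsg A hgen K hK J hJ r s (Res r) (hRes r hr0) t (by linarith)
      hs hs1 hr hN
  have h2 : 2 * (K + 1) / s ≤ m s / 2 := by
    rw [div_le_iff₀ hs]
    linarith [hms s hs hsε]
  nlinarith
end

section
/- Let (T(t))_{t≥0} be a C₀-semigroup on a complex Banach space X with generator −A. If 0 ∈ σ(A), then at least one of the following two properties holds: (i) limsup_{t→∞} t‖T(t)A(I+A)^{-1}‖ > 0; (ii) there are closed subspaces X₀, X₁ of X, each invariant under every T(t), such that X = X₀ ⊕ X₁, T(t)x = x for all t ≥ 0 and x ∈ X₁, and the generator −A₀ of the restriction of the semigroup to X₀ is invertible (0 ∈ ρ(A₀)). -/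
open Filter MeasureTheory Set Complex Asymptotics

lemma sd_idem {R : Type*} [NormedCommRing R] [NormedAlgebra ℂ R] [CompleteSpace R] :
    ∃ δ > (0:ℝ), ∀ p : R, ‖p - p * p‖ < δ → ∃ q g : R, q * q = q ∧
      p * q + (1 - p) * (1 - q) = 1 - g ∧ ‖g‖ ≤ 1/4 := by
  have h1 : HasStrictFDerivAt (fun x : R => x * x)
      (((ContinuousLinearEquiv.smulLeft (Units.mk0 (2:ℂ) two_ne_zero) : R ≃L[ℂ] R)) : R →L[ℂ] R) 1 := by
    have := (hasStrictFDerivAt_id (𝕜 := ℂ) (1:R)).mul (hasStrictFDerivAt_id (𝕜 := ℂ) (1:R))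
    refine this.congr_fderiv ?_
    ext x
    simp [Units.smul_def, two_smul]
  have h2 := h1.map_nhds_eq_of_equiv
  have h3 : (fun x : R => x * x) '' (Metric.ball 1 (1/2)) ∈ nhds ((1:R) * 1) := by
    rw [← h2]; exact image_mem_map (Metric.ball_mem_nhds _ (by norm_num))
  rw [one_mul, Metric.mem_nhds_iff] at h3
  obtain ⟨δ, hδ, hs⟩ := h3
  refine ⟨δ/4, by positivity, fun p hp => ?_⟩
  have h4 : (1 - 4 * (p - p * p)) ∈ Metric.ball (1:R) δ := by
    rw [mem_ball_iff_norm]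
    have : (1 - 4 * (p - p * p)) - 1 = -((4:ℂ) • (p - p * p)) := by
      rw [Algebra.smul_def, map_ofNat]; ring
    rw [this, norm_neg, norm_smul]
    norm_num; linarith
  obtain ⟨z, hz, hzz⟩ := hs h4
  rw [mem_ball_iff_norm] at hz
  have hu : IsUnit z := by
    have := isUnit_one_sub_of_norm_lt_one (x := 1 - z) (by rw [norm_sub_rev]; linarith)
    simpa using this
  obtain ⟨y, hy⟩ := hu.exists_right_inv
  have hh : (2:R) * algebraMap ℂ R (1/2) = 1 := by
    rw [← map_ofNat (algebraMap ℂ R) 2, ← map_mul]; norm_num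
  generalize hc : algebraMap ℂ R (1/2) = c at hh
  simp only at hzz
  refine ⟨c * (1 + (2 * p - 1) * y), c * (1 - z), ?_, ?_, ?_⟩
  · linear_combination (c*c*(z*y+1)) * hy + (-c*c*y*y) * hzz + (c * (1 + (2 * p - 1) * y)) * hh
  · linear_combination p * hh - c * y * hzz + c * z * hy
  · rw [← hc, ← Algebra.smul_def, norm_smul, norm_sub_rev]; norm_num; linarith

lemma sd_abs {R : Type*} [NormedCommRing R] [NormedAlgebra ℂ R] [CompleteSpace R]
    (B : R) (P C : ℕ → R) (h1 : ∀ n, 1 - P n = B * C n)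
    (h2 : Tendsto (fun n => ‖B * P n‖) atTop (nhds 0))
    (h3 : Tendsto (fun n => ‖P n - P n * P n‖) atTop (nhds 0))
    (h4 : Tendsto (fun n => ‖P n - P n * P (n+1)‖) atTop (nhds 0))
    (h5 : Tendsto (fun n => ‖P (n+1) - P (n+1) * P n‖) atTop (nhds 0)) :
    ∃ G : R, B = B * B * G := by
  obtain ⟨δ, hδ, H⟩ := sd_idem (R := R)
  have e := (h3.eventually (gt_mem_nhds hδ)).and ((h4.eventually (gt_mem_nhds (show (0:ℝ) < 1/4 by norm_num))).and
    (h5.eventually (gt_mem_nhds (show (0:ℝ) < 1/4 by norm_num))))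
  obtain ⟨N, hN⟩ := eventually_atTop.1 e
  choose! q g hq hg hgn using fun p => H p
  have key : ∀ p p' : R, ‖p - p * p‖ < δ → ‖p' - p' * p'‖ < δ → ‖p - p * p'‖ < 1/4 →
      q p * (1 - q p') = 0 := by
    intro p p' hp hp' hpp
    have a1 := hgn p hp
    have a2 := hgn p' hp'
    have hu : IsUnit (1 - (g p + g p' - g p * g p' + (p - p * p'))) := by
      apply isUnit_one_sub_of_norm_lt_one
      have b1 := norm_add_le (g p + g p' - g p * g p') (p - p * p')
      have b2 := norm_sub_le (g p + g p') (g p * g p')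
      have b3 := norm_add_le (g p) (g p')
      have b4 := norm_mul_le (g p) (g p')
      have b5 : ‖g p‖ * ‖g p'‖ ≤ 1/4 * (1/4) := mul_le_mul a1 a2 (norm_nonneg _) (by norm_num)
      linarith
    rw [← hu.mul_left_eq_zero]
    have c1 : q p * (1 - g p) = q p * p := by
      rw [← hg p hp]; linear_combination (2 * p - 1) * hq p hp
    have c2 : (1 - q p') * (1 - g p') = (1 - q p') * (1 - p') := by
      rw [← hg p' hp']; linear_combination (1 - 2 * p') * hq p' hp'
    linear_combination (1 - q p') * (1 - g p') * c1 + q p * p * c2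
  have const : ∀ n, N ≤ n → q (P n) = q (P N) := by
    intro n hn
    induction n, hn using Nat.le_induction with
    | base => rfl
    | succ n hn ih =>
      rw [← ih]
      obtain ⟨x1, x2, x3⟩ := hN n hn
      have y1 := (hN (n+1) (by omega)).1
      linear_combination key _ _ y1 x1 x3 - key _ _ x1 y1 x2
  have hBq : B * q (P N) = 0 := by
    rw [← norm_le_zero_iff]
    have : ∀ n, N ≤ n → 3/4 * ‖B * q (P N)‖ ≤ ‖B * P n‖ * ‖q (P N)‖ := by
      intro n hn
      have x1 := (hN n hn).1
      have c1 : B * q (P N) = (B * P n) * q (P N) + (B * q (P N)) * g (P n) := by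
        rw [← const n hn]
        linear_combination B * (2 * P n - 1) * hq _ x1 - B * q (P n) * hg _ x1
      have := norm_add_le ((B * P n) * q (P N)) ((B * q (P N)) * g (P n))
      rw [← c1] at this
      have d1 := norm_mul_le (B * P n) (q (P N))
      have d2 := norm_mul_le (B * q (P N)) (g (P n))
      have d3 := mul_le_mul_of_nonneg_left (hgn _ x1) (norm_nonneg (B * q (P N)))
      linarith
    have lim := h2.mul_const ‖q (P N)‖
    have := ge_of_tendsto lim (eventually_atTop.2 ⟨N, this⟩)
    linarith
  have x1 := (hN N le_rfl).1
  have hu : IsUnit (1 - g (P N)) := isUnit_one_sub_of_norm_lt_one (by linarith [hgn _ x1])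
  obtain ⟨m, hm⟩ := hu.exists_right_inv
  refine ⟨C N * (1 - q (P N)) * m, ?_⟩
  have := hg _ x1
  have h11 := h1 N
  have hqq := hq _ x1
  generalize q (P N) = q at *
  generalize g (P N) = g at *
  generalize P N = p at *
  have c2 : (1 - q) * (1 - g) = B * C N * (1 - q) := by
    linear_combination (-(1 - q)) * this + (1 - 2 * p) * hqq + (1-q) * h11
  linear_combination hBq + B * m * c2 - B * (1 - q) * hm

section sdGen
variable {X : Type*} [NormedAddCommGroup X] [NormedSpace ℂ X]
    {Tsg : C0Semigroup X} {A : X →ₗ.[ℂ] X} {J : X →L[ℂ] X}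

lemma sd_comm_T (Tsg : C0Semigroup X) {s t : ℝ} (hs : 0 ≤ s) (ht : 0 ≤ t) (x : X) :
    Tsg.T s (Tsg.T t x) = Tsg.T t (Tsg.T s x) := by
  have h1 := Tsg.map_add s t hs ht
  have h2 := Tsg.map_add t s ht hs
  rw [add_comm, h2] at h1
  exact (DFunLike.congr_fun h1 x).symm

lemma sd_lim (hgen : IsGenerator Tsg A) (hJ : IsResolvent A 1 J) (x : X) :
    Tendsto (fun t : ℝ => (t : ℂ)⁻¹ • (Tsg.T t (J x) - J x))
        (nhdsWithin 0 (Set.Ioi 0)) (nhds (-(x - J x))) := by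
  rw [← hgen (J x) (x - J x)]
  refine ⟨hJ.mem_domain x, ?_⟩
  have := hJ.eq_apply x
  rw [one_smul] at this
  rw [eq_sub_iff_add_eq, add_comm]; exact this

lemma sd_comm_J (hgen : IsGenerator Tsg A) (hJ : IsResolvent A 1 J) {t : ℝ} (ht : 0 ≤ t) (x : X) :
    Tsg.T t (J x) = J (Tsg.T t x) := by
  have h1 : Tendsto (fun h : ℝ => (h : ℂ)⁻¹ • (Tsg.T h (Tsg.T t (J x)) - Tsg.T t (J x)))
        (nhdsWithin 0 (Set.Ioi 0)) (nhds (-(Tsg.T t (x - J x)))) := by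
    rw [← map_neg]
    refine (((Tsg.T t).continuous.tendsto _).comp (sd_lim hgen hJ x)).congr' ?_
    filter_upwards [self_mem_nhdsWithin] with h hh
    simp only [Function.comp, map_smul, map_sub]
    rw [sd_comm_T Tsg (le_of_lt hh) ht]
  obtain ⟨hd, he⟩ := (hgen _ _).2 h1
  have := hJ.left_inv ⟨_, hd⟩
  rw [he, one_smul] at this
  simp only [← map_add] at this
  rw [add_sub_cancel] at this
  exact this.symm

lemma sd_deriv (hgen : IsGenerator Tsg A) (hJ : IsResolvent A 1 J) {t : ℝ} (ht : 0 ≤ t) (x : X) :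
    HasDerivWithinAt (fun s => Tsg.T s (J x)) (-(Tsg.T t (x - J x))) (Ici t) t := by
  rw [← hasDerivWithinAt_Ioi_iff_Ici, hasDerivWithinAt_iff_tendsto_slope' (by simp)]
  rw [← map_neg]
  have h1 := ((Tsg.T t).continuous.tendsto _).comp (sd_lim hgen hJ x)
  have h2 : Tendsto (fun s : ℝ => s - t) (nhdsWithin t (Ioi t)) (nhdsWithin 0 (Ioi 0)) := by
    refine tendsto_nhdsWithin_iff.2 ⟨?_, ?_⟩
    · refine tendsto_nhdsWithin_of_tendsto_nhds ?_
      have : Continuous (fun s : ℝ => s - t) := by fun_prop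
      simpa using this.tendsto t
    · filter_upwards [self_mem_nhdsWithin] with s hs
      exact sub_pos.2 (mem_Ioi.1 hs)
  refine (h1.comp h2).congr' ?_
  filter_upwards [self_mem_nhdsWithin] with s hs
  have e : Tsg.T s = Tsg.T t ∘L Tsg.T (s - t) := by
    rw [← Tsg.map_add _ _ ht (sub_nonneg.2 (le_of_lt hs)), add_sub_cancel]
  simp only [Function.comp, slope_def_module, e, map_smul, map_sub]
  rw [← Complex.ofReal_inv, Complex.coe_smul]
  rfl

lemma sd_cont (Tsg : C0Semigroup X) {a b : ℝ} (ha : 0 ≤ a) (x : X) :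
    ContinuousOn (fun s => Tsg.T s x) (Icc a b) :=
  (Tsg.strong_continuity x).mono fun _ hs => ha.trans hs.1

lemma sd_diff (hgen : IsGenerator Tsg A) (hJ : IsResolvent A 1 J) {a b ε : ℝ} (ha : 0 ≤ a)
    (hab : a ≤ b) (hε : 0 ≤ ε) (h : ∀ s, a ≤ s → ‖Tsg.T s ∘L ((1 : X →L[ℂ] X) - J)‖ ≤ ε) :
    ‖Tsg.T b ∘L J - Tsg.T a ∘L J‖ ≤ ε * (b - a) := by
  refine ContinuousLinearMap.opNorm_le_bound _ (mul_nonneg hε (sub_nonneg.2 hab)) fun x => ?_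
  have := norm_image_sub_le_of_norm_deriv_right_le_segment (f := fun s => Tsg.T s (J x))
    (C := ε * ‖x‖) (sd_cont Tsg (b := b) ha (J x))
    (fun s hs => sd_deriv hgen hJ (ha.trans hs.1) x) (fun s hs => by
      rw [norm_neg]
      have := (Tsg.T s ∘L ((1 : X →L[ℂ] X) - J)).le_of_opNorm_le (h s hs.1) x
      simpa using this) b ⟨hab, le_rfl⟩
  simp only [ContinuousLinearMap.sub_apply, ContinuousLinearMap.comp_apply]
  linarith

lemma sd_V [CompleteSpace X] (Tsg : C0Semigroup X) {t : ℝ} (ht : 0 ≤ t) :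
    ∃ V : X →L[ℂ] X, ∀ x, V x = ∫ s in (0:ℝ)..t, Tsg.T s x := by
  have hint : ∀ x, IntervalIntegrable (fun s => Tsg.T s x) volume 0 t := fun x =>
    ContinuousOn.intervalIntegrable (by rw [uIcc_of_le ht]; exact sd_cont Tsg le_rfl x)
  obtain ⟨K, hK⟩ : ∃ K, ∀ s : Icc (0:ℝ) t, ‖Tsg.T s‖ ≤ K := by
    refine banach_steinhaus fun x => ?_
    obtain ⟨C, hC⟩ := isCompact_Icc.exists_bound_of_continuousOn (sd_cont Tsg (b := t) le_rfl x)
    exact ⟨C, fun s => hC s s.2⟩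
  let L : X →ₗ[ℂ] X :=
    { toFun := fun x => ∫ s in (0:ℝ)..t, Tsg.T s x
      map_add' := fun x y => by
        simp only [map_add]
        exact intervalIntegral.integral_add (hint x) (hint y)
      map_smul' := fun c x => by
        simp only [map_smul, RingHom.id_apply]
        exact intervalIntegral.integral_smul _ _ }
  refine ⟨L.mkContinuous (K * t) fun x => ?_, fun x => rfl⟩
  have := intervalIntegral.norm_integral_le_of_norm_le_const (a := 0) (b := t)
    (f := fun s => Tsg.T s x) (C := K * ‖x‖) (fun s hs => by
      rw [uIoc_of_le ht] at hs
      exact (Tsg.T s).le_of_opNorm_le (hK ⟨s, hs.1.le, hs.2⟩) x)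
  rw [sub_zero, abs_of_nonneg ht] at this
  change ‖∫ s in (0:ℝ)..t, Tsg.T s x‖ ≤ _
  linarith

lemma sd_V_int [CompleteSpace X] (hgen : IsGenerator Tsg A) (hJ : IsResolvent A 1 J)
    {t : ℝ} (ht : 0 ≤ t) (x : X) :
    ∫ s in (0:ℝ)..t, Tsg.T s (x - J x) = J x - Tsg.T t (J x) := by
  have := intervalIntegral.integral_eq_sub_of_hasDeriv_right (a := 0) (b := t)
    (f := fun s => Tsg.T s (J x)) (f' := fun s => - Tsg.T s (x - J x))
    (by rw [uIcc_of_le ht]; exact sd_cont Tsg le_rfl _)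
    (fun s hs => by
      rw [min_eq_left ht] at hs
      exact (sd_deriv hgen hJ hs.1.le x).mono Ioi_subset_Ici_self)
    (ContinuousOn.intervalIntegrable (by
      rw [uIcc_of_le ht]; exact (sd_cont Tsg le_rfl _).neg))
  rw [intervalIntegral.integral_neg, Tsg.map_zero] at this
  simp only [ContinuousLinearMap.one_apply] at this
  rw [← neg_sub (Tsg.T t (J x)), ← this, neg_neg]

lemma sd_V_comm [CompleteSpace X] {t : ℝ} (ht : 0 ≤ t) {V S : X →L[ℂ] X}
    (hV : ∀ x, V x = ∫ s in (0:ℝ)..t, Tsg.T s x)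
    (hS : ∀ s, 0 ≤ s → ∀ x, S (Tsg.T s x) = Tsg.T s (S x)) (x : X) : S (V x) = V (S x) := by
  rw [hV, hV, ← ContinuousLinearMap.intervalIntegral_comp_comm]
  · refine intervalIntegral.integral_congr fun s hs => ?_
    rw [uIcc_of_le ht] at hs
    exact hS s hs.1 x
  · exact ContinuousOn.intervalIntegrable (by rw [uIcc_of_le ht]; exact sd_cont Tsg le_rfl x)

lemma sd_G [CompleteSpace X] (hgen : IsGenerator Tsg A) (hJ : IsResolvent A 1 J)
    (hlim : ∀ c > (0:ℝ), ∃ t₀ : ℝ, ∀ t, t₀ ≤ t → t * ‖Tsg.T t ∘L ((1 : X →L[ℂ] X) - J)‖ < c) :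
    ∃ G : X →L[ℂ] X, (1 - J) = (1 - J) * (1 - J) * G ∧ G * J = J * G ∧
      ∀ t, 0 ≤ t → G * Tsg.T t = Tsg.T t * G := by
  let s : Set (X →L[ℂ] X) := insert J (Tsg.T '' Ici 0)
  let S : Subalgebra ℂ (X →L[ℂ] X) := Subalgebra.centralizer ℂ (Set.centralizer s)
  have hJT : ∀ t, 0 ≤ t → J * Tsg.T t = Tsg.T t * J := fun t ht => by
    ext x; exact (sd_comm_J hgen hJ ht x).symm
  have hs : s ⊆ Set.centralizer s := by
    rintro a (rfl | ⟨t, ht, rfl⟩) b (rfl | ⟨r, hr, rfl⟩)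
    · rfl
    · exact (hJT r hr).symm
    · exact hJT t ht
    · ext x; exact sd_comm_T Tsg hr ht x
  have hsS : s ⊆ S := fun a ha b hb => (hb a ha).symm
  have hScomm : ∀ a ∈ S, ∀ b ∈ S, a * b = b * a := fun a ha b hb => by
    have hb' : b ∈ Set.centralizer s := fun c hc => hb c (hs hc)
    exact (ha b hb').symm
  have hJS : J ∈ S := hsS (mem_insert _ _)
  have hTS : ∀ t, 0 ≤ t → Tsg.T t ∈ S := fun t ht => hsS (mem_insert_of_mem _ ⟨t, ht, rfl⟩)
  have hV : ∀ t, 0 ≤ t → ∃ V ∈ S, (1 - J) * V = (1 - Tsg.T t) * J := by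
    intro t ht
    obtain ⟨V, hV⟩ := sd_V Tsg ht
    have hVS : V ∈ S := fun b hb => by
      ext x
      exact sd_V_comm ht hV (fun r hr y =>
        (DFunLike.congr_fun (hb _ (mem_insert_of_mem _ ⟨r, hr, rfl⟩)) y).symm) x
    refine ⟨V, hVS, ?_⟩
    rw [hScomm _ (S.sub_mem S.one_mem hJS) _ hVS]
    ext x
    simpa using (hV (x - J x)).trans (sd_V_int hgen hJ ht x)
  have hclosed : IsClosed (S : Set (X →L[ℂ] X)) := Set.isClosed_centralizer _
  haveI : CompleteSpace S := hclosed.completeSpace_coe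
  letI : NormedCommRing S :=
    { (inferInstance : NormedRing S) with
      mul_comm := fun a b => Subtype.ext (hScomm a a.2 b b.2) }
  have h2 : ∀ n : ℕ, (0:ℝ) ≤ 2 ^ n := fun n => by positivity
  choose V hVS hVe using fun n : ℕ => hV (2 ^ n) (h2 n)
  -- estimates
  have est : ∀ ε > 0, ∃ t₀ > 0, ∀ a b : ℝ, t₀ ≤ a → a ≤ 2 * b → b ≤ 2 * a →
      ‖Tsg.T a * J - (Tsg.T a * J) * (Tsg.T b * J)‖ < ε ∧ ‖(1 - J) * (Tsg.T a * J)‖ < ε := by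
    intro ε hε
    have hc : 0 < ε / (4 * (1 + ‖J‖)) := by positivity
    obtain ⟨t₀, ht₀⟩ := hlim _ hc
    refine ⟨max t₀ 1, by positivity, fun a b ha hab hba => ?_⟩
    set c := ε / (4 * (1 + ‖J‖)) with hcd
    have ha0 : t₀ ≤ a := (le_max_left _ _).trans ha
    have ha1 : 1 ≤ a := (le_max_right _ _).trans ha
    have hb0 : 0 ≤ b := by linarith
    have hb : ∀ r, a ≤ r → ‖Tsg.T r ∘L ((1 : X →L[ℂ] X) - J)‖ ≤ c / a := by
      intro r hr
      rw [le_div_iff₀ (by linarith), mul_comm]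
      refine le_trans ?_ (ht₀ r (ha0.trans hr)).le
      exact mul_le_mul_of_nonneg_right hr (norm_nonneg _)
    have hca : c / a ≤ c := div_le_self hc.le ha1
    have d1 := sd_diff hgen hJ (a := a) (b := a + b) (by linarith) (by linarith) (by positivity) hb
    have d2 : ∀ r, a ≤ r → ‖(1 - J) * (Tsg.T r * J)‖ ≤ c * ‖J‖ := by
      intro r hr
      have : (1 - J) * (Tsg.T r * J) = (Tsg.T r ∘L (1 - J)) * J := by
        rw [← mul_assoc]; congr 1
        exact hScomm _ (S.sub_mem S.one_mem hJS) _ (hTS r (by linarith))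
      rw [this]
      exact (norm_mul_le _ _).trans
        (mul_le_mul_of_nonneg_right ((hb r hr).trans hca) (norm_nonneg _))
    have hcb : c / a * (a + b - a) ≤ 2 * c := by
      rw [div_mul_eq_mul_div, div_le_iff₀ (by linarith)]
      nlinarith
    have hfin : 2 * c + c * ‖J‖ < ε := by
      have : c * (4 * (1 + ‖J‖)) = ε := div_mul_cancel₀ _ (by positivity)
      have := mul_nonneg hc.le (norm_nonneg J)
      nlinarith
    constructor
    · have : Tsg.T a * J - (Tsg.T a * J) * (Tsg.T b * J) =
          -(Tsg.T (a + b) ∘L J - Tsg.T a ∘L J) + (1 - J) * (Tsg.T (a + b) * J) := by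
        have e1 : (Tsg.T a * J) * (Tsg.T b * J) = J * (Tsg.T (a + b) * J) := by
          rw [Tsg.map_add a b (by linarith) hb0, ← hJT a (by linarith)]
          simp only [← ContinuousLinearMap.mul_def, mul_assoc]
        rw [e1, sub_mul, one_mul]
        simp only [← ContinuousLinearMap.mul_def]
        abel
      rw [this]
      refine (norm_add_le _ _).trans_lt ?_
      rw [norm_neg]
      linarith [d2 (a + b) (by linarith)]
    · linarith [d2 a le_rfl]
  have tend : ∀ f : ℕ → ℝ, (∀ n, 0 ≤ f n) → (∀ ε > 0, ∃ t₀ : ℝ, ∀ n : ℕ, t₀ ≤ 2 ^ n → f n < ε) →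
      Tendsto f atTop (nhds 0) := by
    intro f hf h
    rw [Metric.tendsto_nhds]
    intro ε hε
    obtain ⟨t₀, h⟩ := h ε hε
    filter_upwards [(tendsto_pow_atTop_atTop_of_one_lt (one_lt_two (α := ℝ))).eventually_ge_atTop t₀]
      with n hn
    rw [Real.dist_eq, sub_zero, abs_of_nonneg (hf n)]
    exact h n hn
  have := sd_abs (R := S) ⟨1 - J, S.sub_mem S.one_mem hJS⟩
    (fun n => ⟨Tsg.T (2 ^ n) * J, S.mul_mem (hTS _ (h2 n)) hJS⟩)
    (fun n => ⟨1 + V n, S.add_mem S.one_mem (hVS n)⟩)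
    (fun n => Subtype.ext (by
      change 1 - Tsg.T (2 ^ n) * J = (1 - J) * (1 + V n)
      rw [mul_add, hVe]; noncomm_ring))
    (tend _ (fun n => norm_nonneg _) fun ε hε => by
      obtain ⟨t₀, -, h⟩ := est ε hε
      exact ⟨t₀, fun n hn => (h _ (2 ^ n) hn (by linarith [h2 n]) (by linarith [h2 n])).2⟩)
    (tend _ (fun n => norm_nonneg _) fun ε hε => by
      obtain ⟨t₀, -, h⟩ := est ε hε
      exact ⟨t₀, fun n hn => (h _ (2 ^ n) hn (by linarith [h2 n]) (by linarith [h2 n])).1⟩)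
    (tend _ (fun n => norm_nonneg _) fun ε hε => by
      obtain ⟨t₀, -, h⟩ := est ε hε
      exact ⟨t₀, fun n hn => (h _ (2 ^ (n+1)) hn (by rw [pow_succ]; linarith [h2 n])
        (by rw [pow_succ]; linarith [h2 n])).1⟩)
    (tend _ (fun n => norm_nonneg _) fun ε hε => by
      obtain ⟨t₀, -, h⟩ := est ε hε
      exact ⟨t₀, fun n hn => (h (2 ^ (n+1)) (2 ^ n) (by rw [pow_succ]; linarith [h2 n])
        (by rw [pow_succ]; linarith [h2 n]) (by rw [pow_succ]; linarith [h2 n])).1⟩)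
  obtain ⟨G, hG⟩ := this
  exact ⟨G, congrArg Subtype.val hG, hScomm _ G.2 _ hJS, fun t ht => hScomm _ G.2 _ (hTS t ht)⟩

end sdGen

/-- splitting dichotomy.  Let `(T(t))_{t≥0}` be a `C₀`-semigroup on a
complex Banach space `X` with generator `−A` (boundedness not assumed) and `0 ∈ σ(A)`.
Then either `limsup_{t→∞} t‖T(t)A(I+A)⁻¹‖ > 0`, or `X` splits as a direct sum of closed
`T`-invariant subspaces `X₀ ⊕ X₁` such that `T(t) = I` on `X₁` and the generator of the
restriction of the semigroup to `X₀` (which is the restriction of `−A`) is invertible.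
(Here `A(I+A)⁻¹ = 1 - J` with `J = (1+A)⁻¹`.) -/
theorem splitting_dichotomy_zero_in_spectrum
    {X : Type*} [NormedAddCommGroup X] [NormedSpace ℂ X] [CompleteSpace X]
    (Tsg : C0Semigroup X)
    (A : X →ₗ.[ℂ] X) (hgen : IsGenerator Tsg A)
    (h0 : ¬ ∃ R : X →L[ℂ] X, IsResolvent A 0 R)
    (J : X →L[ℂ] X) (hJ : IsResolvent A 1 J) :
    (∃ c > (0 : ℝ), ∀ t₀ : ℝ, ∃ t : ℝ, t₀ ≤ t ∧
      c ≤ t * ‖Tsg.T t ∘L ((1 : X →L[ℂ] X) - J)‖) ∨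
    (∃ X₀ X₁ : Submodule ℂ X,
      IsClosed (X₀ : Set X) ∧ IsClosed (X₁ : Set X) ∧ IsCompl X₀ X₁ ∧
      (∀ t : ℝ, 0 ≤ t → ∀ x ∈ X₀, Tsg.T t x ∈ X₀) ∧
      (∀ t : ℝ, 0 ≤ t → ∀ x ∈ X₁, Tsg.T t x ∈ X₁) ∧
      (∀ t : ℝ, 0 ≤ t → ∀ x ∈ X₁, Tsg.T t x = x) ∧
      (∃ R : X →L[ℂ] X,
        (∀ x ∈ X₀, R x ∈ X₀) ∧
        (∀ x ∈ X₀, ∃ h : R x ∈ A.domain, A ⟨R x, h⟩ = x) ∧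
        (∀ x : A.domain, (x : X) ∈ X₀ → R (A x) = x))) := by
  by_cases hcase : ∃ c > (0 : ℝ), ∀ t₀ : ℝ, ∃ t : ℝ, t₀ ≤ t ∧
      c ≤ t * ‖Tsg.T t ∘L ((1 : X →L[ℂ] X) - J)‖
  · exact Or.inl hcase
  right
  push Not at hcase
  obtain ⟨G, hG, hGJ, hGT⟩ := sd_G hgen hJ hcase
  have gj : ∀ x, G (J x) = J (G x) := fun x => DFunLike.congr_fun hGJ x
  have gt : ∀ t, 0 ≤ t → ∀ x, G (Tsg.T t x) = Tsg.T t (G x) :=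
    fun t ht x => DFunLike.congr_fun (hGT t ht) x
  let B : X →L[ℂ] X := 1 - J
  have hB : ∀ x, B x = x - J x := fun x => rfl
  have gb : ∀ x, G (B x) = B (G x) := fun x => by rw [hB, hB, map_sub, gj]
  have jb : ∀ x, J (B x) = B (J x) := fun x => by rw [hB, hB, map_sub]
  have bt : ∀ t, 0 ≤ t → ∀ x, B (Tsg.T t x) = Tsg.T t (B x) := fun t ht x => by
    rw [hB, hB, map_sub, sd_comm_J hgen hJ ht]
  have hbb : ∀ x, B (B (G x)) = B x := fun x => (DFunLike.congr_fun hG x).symm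
  have hfix : ∀ t, 0 ≤ t → ∀ x, B x = 0 → Tsg.T t x = x := by
    intro t ht x hx
    have h1 := sd_V_int hgen hJ ht x
    rw [← hB, hx] at h1
    have h2 : J x = x := by rw [hB, sub_eq_zero] at hx; exact hx.symm
    simp only [map_zero, intervalIntegral.integral_zero, h2] at h1
    exact (sub_eq_zero.1 h1.symm).symm
  refine ⟨LinearMap.ker ((1 - B * G : X →L[ℂ] X) : X →ₗ[ℂ] X), LinearMap.ker (B : X →ₗ[ℂ] X),
    (1 - B * G : X →L[ℂ] X).isClosed_ker, B.isClosed_ker, ?_, ?_, ?_, ?_, J * G, ?_, ?_, ?_⟩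
  all_goals
    have m0 : ∀ x, x ∈ LinearMap.ker ((1 - B * G : X →L[ℂ] X) : X →ₗ[ℂ] X) ↔ B (G x) = x := by
      intro x
      rw [LinearMap.mem_ker]
      change x - B (G x) = 0 ↔ _
      rw [sub_eq_zero, eq_comm]
    have m1 : ∀ x, x ∈ LinearMap.ker (B : X →ₗ[ℂ] X) ↔ B x = 0 := fun x => LinearMap.mem_ker
    try simp only [m0, m1]
  · refine ⟨?_, ?_⟩
    · rw [Submodule.disjoint_def]
      intro x hx hx'
      rw [m0] at hx
      rw [m1] at hx'
      rw [← hx, ← gb, hx', map_zero]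
    · rw [codisjoint_iff, Submodule.eq_top_iff']
      intro x
      refine Submodule.mem_sup.2 ⟨B (G x), ?_, x - B (G x), ?_, by abel⟩
      · rw [m0, gb, hbb]
      · rw [m1, map_sub, hbb, sub_self]
  · intro t ht x hx
    rw [gt t ht, bt t ht, hx]
  · intro t ht x hx
    rw [bt t ht, hx, map_zero]
  · exact hfix
  · intro x hx
    change B (G (J (G x))) = J (G x)
    rw [gj, ← jb, ← gb, hx]
  · intro x hx
    refine ⟨hJ.mem_domain _, ?_⟩
    have := hJ.eq_apply (G x)
    rw [one_smul] at this
    refine Eq.trans ?_ hx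
    rw [hB]
    exact eq_sub_of_add_eq' this
  · intro x hx
    have h1 := hJ.left_inv x
    rw [one_smul] at h1
    have h2 : A x = B (x + A x) := by rw [hB, h1]; abel
    change J (G (A x)) = x
    rw [h2, gb, jb, ← gj, h1, hx]
end

section
/- Let A be a sectorial operator on a complex Banach space X and let α, β ∈ [0,1]. Then: (i) ran( A^α (I+A)^{-(α+β)} ) = ran(A^α) ∩ dom(A^β); (ii) the operator A^α (I+A)^{-β} is sectorial. -/
open Filter MeasureTheory Set Complex Asymptotics

/-- A densely defined (partial) operator `A` is sectorial:  `(lam + A)⁻¹` exists for all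
`lam > 0` and `sup_{lam>0} ‖lam (lam+A)⁻¹‖ < ∞`. -/
def IsSectorialOp {X : Type*} [NormedAddCommGroup X] [NormedSpace ℂ X]
    (A : X →ₗ.[ℂ] X) : Prop :=
  Dense (A.domain : Set X) ∧
    ∃ C : ℝ, ∀ lam : ℝ, 0 < lam →
      ∃ R : X →L[ℂ] X, IsResolvent A (lam : ℂ) R ∧ lam * ‖R‖ ≤ C

/-- The graph of the (possibly unbounded) operator `A^α (I+A)^{-β}`, expressed through
the bounded operators `B(A)^α = (1-J)^α = A^α(I+A)^{-α}` and `J^γ = (I+A)^{-γ}`, where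
`J = (1+A)⁻¹`:  for `α ≤ β` it is the bounded operator `B(A)^α J^{β-α}`, and for
`α > β` one has `y = A^α(I+A)^{-β} x` iff `J^{α-β} y = B(A)^α x`. -/
def fracPowerGraph {X : Type*} [NormedAddCommGroup X] [NormedSpace ℂ X] [CompleteSpace X]
    (J : X →L[ℂ] X) (α β : ℝ) : X → X → Prop := fun x y =>
  if α ≤ β then y = (opPow ((1 : X →L[ℂ] X) - J) α * opPow J (β - α)) x
  else opPow J (α - β) y = opPow ((1 : X →L[ℂ] X) - J) α x

noncomputable section
namespace FracAux

/-- The double commutant of a set. -/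
def bic {E : Type*} [NormedRing E] [NormedAlgebra ℂ E] (S : Set E) : Subalgebra ℂ E :=
  Subalgebra.centralizer ℂ (Subalgebra.centralizer ℂ S : Set E)

lemma mem_bic {E : Type*} [NormedRing E] [NormedAlgebra ℂ E] {S : Set E} {x : E} :
    x ∈ bic S ↔ ∀ y : E, (∀ s ∈ S, s * y = y * s) → y * x = x * y := by
  rw [bic, Subalgebra.mem_centralizer_iff]
  simp only [Subalgebra.coe_centralizer, Set.mem_centralizer_iff]

lemma bic_of_mem {E : Type*} [NormedRing E] [NormedAlgebra ℂ E] {S : Set E} {x : E}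
    (h : x ∈ S) : x ∈ bic S := mem_bic.2 fun _ hy => (hy x h).symm

lemma bic_inverse {E : Type*} [NormedRing E] [NormedAlgebra ℂ E] {S : Set E} {x : E}
    (h : x ∈ bic S) : Ring.inverse x ∈ bic S := by
  rw [mem_bic] at *
  intro y hy
  have h1 : Commute y x := h y hy
  by_cases hu : IsUnit x
  · obtain ⟨u, rfl⟩ := hu
    rw [Ring.inverse_unit]
    exact h1.units_inv_right
  · rw [Ring.inverse_non_unit x hu]; simp

lemma bic_of_inv {E : Type*} [NormedRing E] [NormedAlgebra ℂ E] {S : Set E} {x z : E}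
    (h : x ∈ bic S) (h1 : x * z = 1) (h2 : z * x = 1) : z ∈ bic S := by
  rw [mem_bic] at *
  intro y hy
  have h3 := h y hy
  calc y * z = z * x * (y * z) := by rw [h2, one_mul]
    _ = z * (x * y) * z := by simp only [mul_assoc]
    _ = z * (y * x) * z := by rw [h3]
    _ = z * y * (x * z) := by simp only [mul_assoc]
    _ = z * y := by rw [h1, mul_one]

lemma bic_integral {E : Type*} [NormedRing E] [NormedAlgebra ℂ E] [CompleteSpace E]
    {S : Set E} {f : ℝ → E} {U : Set ℝ} (hU : MeasurableSet U)
    (h : ∀ t ∈ U, f t ∈ bic S) : (∫ t in U, f t) ∈ bic S := by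
  by_cases hi : Integrable f (volume.restrict U)
  swap
  · rw [integral_undef hi]; exact zero_mem _
  rw [mem_bic]
  intro y hy
  have e1 := (ContinuousLinearMap.mul ℂ E y).integral_comp_comm hi
  have e2 := ((ContinuousLinearMap.mul ℂ E).flip y).integral_comp_comm hi
  simp only [ContinuousLinearMap.mul_apply', ContinuousLinearMap.flip_apply] at e1 e2
  rw [← e1, ← e2]
  apply setIntegral_congr_fun hU
  intro t ht
  exact mem_bic.1 (h t ht) y hy

/-- `φ` behaves as a character on the double commutant of `S`. -/
structure IsChar {E : Type*} [NormedRing E] [NormedAlgebra ℂ E] (S : Set E)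
    (φ : E →L[ℂ] ℂ) : Prop where
  one : φ 1 = 1
  mul : ∀ x ∈ bic S, ∀ y ∈ bic S, φ (x * y) = φ x * φ y

lemma exists_char {E : Type*} [NormedRing E] [NormedAlgebra ℂ E] [CompleteSpace E]
    (S : Set E) (hS : ∀ x ∈ S, ∀ y ∈ S, x * y = y * x) (v : E) (hv : v ∈ bic S)
    (hu : ¬ IsUnit v) : ∃ φ : E →L[ℂ] ℂ, IsChar S φ ∧ φ v = 0 := by
  have hcl : IsClosed (bic S : Set E) := Set.isClosed_centralizer _
  have hcm : ∀ x y : bic S, x * y = y * x := by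
    intro x y
    apply Subtype.ext
    exact Set.centralizer_centralizer_comm_of_comm hS _ x.2 _ y.2
  let _ : NormedCommRing (bic S) := { (inferInstance : NormedRing (bic S)) with mul_comm := hcm }
  have : CompleteSpace (bic S) := hcl.completeSpace_coe
  have hnu : ¬ IsUnit (⟨v, hv⟩ : bic S) := by
    intro h
    exact hu (h.map (bic S).val)
  obtain ⟨f, hf⟩ := WeakDual.CharacterSpace.exists_apply_eq_zero (A := bic S) hnu
  have hfc : Continuous f := map_continuous f
  let g : StrongDual ℂ (Subalgebra.toSubmodule (bic S)) :=
    ⟨⟨⟨fun x => f x, fun x y => map_add f x y⟩, fun c x => map_smul f c x⟩, hfc⟩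
  obtain ⟨φ, hφ, -⟩ := exists_extension_norm_eq (𝕜 := ℂ) (Subalgebra.toSubmodule (bic S)) g
  have key : ∀ x (hx : x ∈ bic S), φ x = f ⟨x, hx⟩ := fun x hx => hφ ⟨x, hx⟩
  refine ⟨φ, ⟨?_, ?_⟩, ?_⟩
  · rw [key 1 (one_mem _)]; exact map_one f
  · intro x hx y hy
    rw [key _ (mul_mem hx hy), key _ hx, key _ hy, ← map_mul]; rfl
  · rw [key _ hv, hf]

lemma IsChar.algebraMap_re {E : Type*} [NormedRing E] [NormedAlgebra ℂ E] {S : Set E}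
    {φ : E →L[ℂ] ℂ} (h : IsChar S φ) (c : ℂ) : φ (c • (1 : E)) = c := by
  simp [h.one]

/-! ### scalars -/

/-- all positive combinations of `b` and `j` are nonzero -/
structure PosPair (b j : ℂ) : Prop where
  sum : b + j = 1
  ne : ∀ X Y : ℝ, 0 < X → 0 < Y → (X : ℂ) * b + Y * j ≠ 0

lemma PosPair.symm {b j : ℂ} (h : PosPair b j) : PosPair j b :=
  ⟨by rw [add_comm]; exact h.sum, fun X Y hX hY => by
    rw [add_comm]; exact h.ne Y X hY hX⟩

/-- qualitative information on `x = b ^ α`, `0 ≤ α ≤ 1` -/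
structure ConeVal (b x : ℂ) : Prop where
  ex : ∃ X Y : ℝ, 0 ≤ X ∧ 0 ≤ Y ∧ x = X + Y * b ∧ (b ≠ 0 → 0 < X + Y)
  one : b = 1 → x = 1

lemma coneVal_one (b : ℂ) : ConeVal b 1 := ⟨⟨1, 0, by simp⟩, fun _ => rfl⟩
lemma coneVal_self (b : ℂ) : ConeVal b b := ⟨⟨0, 1, by simp⟩, fun h => h⟩

lemma real_pos_combo {b j x y : ℂ} (h : PosPair b j) (hx : ConeVal b x) (hy : ConeVal j y)
    (r s l : ℝ) (hr : 0 < r) (hs : 0 < s) (hl : 0 ≤ l) : (r : ℂ) * x + s * y + l ≠ 0 := by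
  obtain ⟨X, Y, hX, hY, rfl, hp⟩ := hx.ex
  obtain ⟨X', Y', hX', hY', rfl, hp'⟩ := hy.ex
  by_cases hb : b = 0
  · subst hb
    have hj : j = 1 := by simpa using h.sum
    subst hj
    have h1 := hp' one_ne_zero
    have : (r : ℂ) * (X + Y * 0) + s * (X' + Y' * 1) + l = ((r * X + s * (X' + Y') + l : ℝ) : ℂ) := by
      push_cast; ring
    rw [this]
    have : 0 < r * X + s * (X' + Y') + l := by positivity
    exact_mod_cast this.ne'
  by_cases hj : j = 0
  · subst hj
    have hj : b = 1 := by simpa using h.sum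
    subst hj
    have h1 := hp one_ne_zero
    have : (r : ℂ) * (X + Y * 1) + s * (X' + Y' * 0) + l = ((r * (X + Y) + s * X' + l : ℝ) : ℂ) := by
      push_cast; ring
    rw [this]
    have : 0 < r * (X + Y) + s * X' + l := by positivity
    exact_mod_cast this.ne'
  have h1 := hp hb
  have h2 := hp' hj
  have e : (r : ℂ) * (X + Y * b) + s * (X' + Y' * j) + l
      = ((r * (X + Y) + s * X' + l : ℝ) : ℂ) * b + ((r * X + s * (X' + Y') + l : ℝ) : ℂ) * j := by
    push_cast
    linear_combination (-(r : ℂ) * X - s * X' - l) * h.sum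
  rw [e]
  exact h.ne _ _ (by positivity) (by positivity)

lemma ConeVal.zero {b j x : ℂ} (h : PosPair b j) (hx : ConeVal b x) (h0 : x = 0) : b = 0 := by
  obtain ⟨X, Y, hX, hY, rfl, hp⟩ := hx.ex
  by_contra hb
  have h1 := hp hb
  rcases hX.eq_or_lt with h2 | h2
  · subst h2
    have : (Y : ℂ) ≠ 0 := by
      have : 0 < Y := by simpa using h1
      exact_mod_cast this.ne'
    simp_all
  · apply h.ne (X + Y) X h1 h2
    push_cast
    linear_combination h0 + X * h.sum

lemma ConeVal.nonneg {b x : ℂ} (hx : ConeVal b x) (hb : 0 ≤ b.re) (hi : b.im = 0) :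
    0 ≤ x.re ∧ x.im = 0 := by
  obtain ⟨X, Y, hX, hY, rfl, hp⟩ := hx.ex
  simp [hi]; positivity

lemma N3 {b j x y : ℂ} (h : PosPair b j) (hx : ConeVal b x) (hy : ConeVal j y)
    (l : ℝ) (hl : 0 ≤ l) : 1 + l * (x * y) ≠ 0 := by
  have him : b.im + j.im = 0 := by simpa using congrArg Complex.im h.sum
  have hre : b.re + j.re = 1 := by simpa using congrArg Complex.re h.sum
  have fin : 0 ≤ x.re → x.im = 0 → 0 ≤ y.re → y.im = 0 → 1 + l * (x * y) ≠ 0 := by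
    intro a1 a2 a3 a4 h0
    have := congrArg Complex.re h0
    simp [a2, a4] at this
    have h3 : 0 ≤ l * (x.re * y.re) := by positivity
    linarith
  by_cases hb : b.im = 0
  · have hj : j.im = 0 := by linarith
    have b0 : 0 ≤ b.re := by
      by_contra hneg
      push Not at hneg
      apply h.ne j.re (-b.re) (by linarith) (by linarith)
      apply Complex.ext <;> simp [hb, hj]
      ring
    have j0 : 0 ≤ j.re := by
      by_contra hneg
      push Not at hneg
      apply h.ne (-j.re) (b.re) (by linarith) (by linarith)
      apply Complex.ext <;> simp [hb, hj]
      ring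
    have h1 := hx.nonneg b0 hb
    have h2 := hy.nonneg j0 hj
    exact fin h1.1 h1.2 h2.1 h2.2
  · obtain ⟨X, Y, hX, hY, ex, hp⟩ := hx.ex
    obtain ⟨X', Y', hX', hY', ey, hp'⟩ := hy.ex
    have xr : x.re = X + Y * b.re := by simp [ex]
    have xi : x.im = Y * b.im := by simp [ex]
    have yr : y.re = X' + Y' * j.re := by simp [ey]
    have yi : y.im = -(Y' * b.im) := by
      have : j.im = - b.im := by linarith
      simp [ey, this]
    intro h0
    have r0 := congrArg Complex.re h0
    have i0 := congrArg Complex.im h0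
    simp at r0 i0
    have k1 : x.im * (l * (y.re ^ 2 + y.im ^ 2)) = y.im := by
      rcases i0 with i0 | i0
      · subst i0; simp at r0
      · linear_combination l * y.re * i0 - y.im * r0
    have k2 : b.im * (Y * (l * (y.re ^ 2 + y.im ^ 2)) + Y') = 0 := by
      linear_combination k1 - (l * (y.re ^ 2 + y.im ^ 2)) * xi + yi
    have k3 := (mul_eq_zero.1 k2).resolve_left hb
    have k4 : 0 ≤ Y * (l * (y.re ^ 2 + y.im ^ 2)) := by positivity
    have k5 : Y' = 0 := by linarith
    have yi0 : y.im = 0 := by rw [yi, k5]; simp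
    have xy0 : Y = 0 ∨ Y ≠ 0 := em _
    have yr0 : 0 ≤ y.re := by rw [yr, k5]; simpa using hX'
    rcases xy0 with h5 | h5
    · exact fin (by rw [xr, h5]; simpa using hX) (by rw [xi, h5]; simp) yr0 yi0 h0
    · have : l * (y.re ^ 2 + y.im ^ 2) = 0 := by
        have : Y * (l * (y.re ^ 2 + y.im ^ 2)) = 0 := by linarith
        exact (mul_eq_zero.1 this).resolve_left h5
      rw [yi0] at this r0
      rcases mul_eq_zero.1 this with h6 | h6
      · rw [h6] at r0; simp at r0
      · have : y.re = 0 := by simpa using h6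
        rw [this] at r0; simp at r0

lemma N1 {b j x y p : ℂ} (h : PosPair b j) (hx : ConeVal b x) (hy : ConeVal j y)
    (l : ℝ) (hl : 0 ≤ l) (hp : p * (l + x) = l) : p * y + 1 - p ≠ 0 := by
  intro h0
  have e : l * y + x = 0 := by linear_combination (l + x) * h0 - (y - 1) * hp
  rcases hl.eq_or_lt with h1 | h1
  · subst h1
    have x0 : x = 0 := by simpa using e
    have b0 := hx.zero h x0
    have j1 : j = 1 := by simpa [b0] using h.sum
    rw [hy.one j1] at h0
    simp at h0
  · apply real_pos_combo h hx hy 1 l 0 one_pos h1 le_rfl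
    simp
    linear_combination e

lemma N2 {b j x y p q : ℂ} (h : PosPair b j) (hx : ConeVal b x) (hy : ConeVal j y)
    (l : ℝ) (hl : 0 ≤ l) (hp : p * (l + x) = l) (hq : q * (l + y) = l) :
    p + q + (1 - p) * y + (1 - q) * x ≠ 0 := by
  intro h0
  rcases hl.eq_or_lt with h1 | h1
  · subst h1
    simp at hp hq
    by_cases p0 : p = 0
    · by_cases q0 : q = 0
      · apply real_pos_combo h hx hy 1 1 0 one_pos one_pos le_rfl
        simp [p0, q0] at h0 ⊢
        linear_combination h0
      · have y0 := hq.resolve_left q0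
        have j0 := hy.zero h.symm y0
        have b1 : b = 1 := by simpa [j0] using h.sum
        rw [hx.one b1, y0, p0] at h0
        simp at h0
    · have x0 := hp.resolve_left p0
      have b0 := hx.zero h x0
      have j1 : j = 1 := by simpa [b0] using h.sum
      have y1 := hy.one j1
      rw [y1] at hq
      have q0 : q = 0 := by simpa using hq
      rw [y1, x0, q0] at h0
      simp at h0
  · have l0 : (l : ℂ) ≠ 0 := by exact_mod_cast h1.ne'
    have e : (p + q) * (l + x * y) = 0 := by
      linear_combination l * h0 + y * hp + x * hq
    have e2 : (p + q) * ((l + x) * (l + y)) = l * (1 * x + 1 * y + (2 * l)) := by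
      linear_combination (l + y) * hp + (l + x) * hq
    rcases mul_eq_zero.1 e with h3 | h3
    · rw [h3] at e2
      have := real_pos_combo h hx hy 1 1 (2 * l) one_pos one_pos (by positivity)
      push_cast at this
      have e3 := mul_ne_zero l0 this
      apply e3
      rw [← e2]; ring
    · apply N3 h hx hy l⁻¹ (by positivity)
      push_cast
      field_simp
      simpa using h3

end FracAux
end

noncomputable section
namespace FracAux

lemma base_int {α : ℝ} (h0 : 0 < α) (h1 : α < 1) :
    IntegrableOn (fun t : ℝ => t ^ (α - 1) * (1 + t)⁻¹) (Ioi 0) := by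
  rw [← Ioc_union_Ioi_eq_Ioi (zero_le_one' ℝ)]
  have hc : ContinuousOn (fun t : ℝ => t ^ (α - 1) * (1 + t)⁻¹) (Ioi 0) := by
    apply ContinuousOn.mul
    · exact continuousOn_id.rpow_const fun x hx => Or.inl (ne_of_gt hx)
    · apply ContinuousOn.inv₀ (by fun_prop)
      intro x hx
      have : (0 : ℝ) < x := hx
      positivity
  apply IntegrableOn.union
  · have i1 : IntegrableOn (fun t : ℝ => t ^ (α - 1)) (Ioc 0 1) :=
      (intervalIntegrable_iff_integrableOn_Ioc_of_le zero_le_one).1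
        (intervalIntegral.intervalIntegrable_rpow' (by linarith))
    refine Integrable.mono' i1 ((hc.mono Ioc_subset_Ioi_self).aestronglyMeasurable measurableSet_Ioc) ?_
    filter_upwards [ae_restrict_mem measurableSet_Ioc] with t ht
    have h2 : 0 < t := ht.1
    rw [Real.norm_of_nonneg (by positivity)]
    apply mul_le_of_le_one_right (by positivity)
    apply inv_le_one_of_one_le₀; linarith
  · have i1 : IntegrableOn (fun t : ℝ => t ^ (α - 2)) (Ioi 1) :=
      integrableOn_Ioi_rpow_of_lt (by linarith) one_pos
    refine Integrable.mono' i1 ((hc.mono (Ioi_subset_Ioi zero_le_one)).aestronglyMeasurable measurableSet_Ioi) ?_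
    filter_upwards [ae_restrict_mem measurableSet_Ioi] with t ht
    have h2 : 0 < t := lt_trans one_pos ht
    rw [Real.norm_of_nonneg (by positivity)]
    have : t ^ (α - 2) = t ^ (α - 1) * t⁻¹ := by
      rw [← Real.rpow_neg_one t, ← Real.rpow_add h2]; congr 1; ring
    rw [this]
    gcongr
    linarith

lemma integral_base {α : ℝ} (h0 : 0 < α) (h1 : α < 1) :
    ∫ t in Ioi (0 : ℝ), t ^ (α - 1) * (1 + t)⁻¹ = Real.pi / Real.sin (Real.pi * α) := by
  have him : (fun t : ℝ => t / (1 + t)) '' Ioi 0 = Ioo 0 1 := by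
    ext x
    constructor
    · rintro ⟨t, ht, rfl⟩
      have ht : (0 : ℝ) < t := ht
      refine ⟨by positivity, ?_⟩
      rw [div_lt_one (by positivity)]; linarith
    · rintro ⟨hx0, hx1⟩
      have : 0 < 1 - x := by linarith
      refine ⟨x / (1 - x), ?_, ?_⟩
      · show 0 < x / (1 - x); positivity
      · field_simp; ring
  have e1 := integral_image_eq_integral_abs_deriv_smul (s := Ioi (0:ℝ))
    (f := fun t : ℝ => t / (1 + t)) (f' := fun t => 1 / (1 + t) ^ 2) measurableSet_Ioi
    (by
      intro t ht
      have ht : (0 : ℝ) < t := ht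
      have h3 : (1 + t) ≠ 0 := by positivity
      have := ((hasDerivAt_id t).div ((hasDerivAt_id t).const_add 1) h3).hasDerivWithinAt (s := Ioi 0)
      refine this.congr_deriv ?_
      simp)
    (by
      intro a ha b hb hab
      have ha : (0 : ℝ) < a := ha
      have hb : (0 : ℝ) < b := hb
      have : a / (1 + a) = b / (1 + b) := hab
      field_simp at this
      linarith)
    (fun x : ℝ => x ^ (α - 1) * (1 - x) ^ ((1 - α) - 1))
  rw [him] at e1
  have e2 : ∫ t in Ioi (0 : ℝ), t ^ (α - 1) * (1 + t)⁻¹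
      = ∫ x in Ioo (0:ℝ) 1, x ^ (α - 1) * (1 - x) ^ ((1 - α) - 1) := by
    rw [e1]
    apply setIntegral_congr_fun measurableSet_Ioi
    intro t ht
    have ht : (0 : ℝ) < t := ht
    have h3 : 0 < 1 + t := by positivity
    have h4 : 1 - t / (1 + t) = (1 + t)⁻¹ := by field_simp; ring
    simp only [smul_eq_mul]
    rw [h4, abs_of_pos (by positivity), Real.div_rpow ht.le h3.le, Real.inv_rpow h3.le,
      ← Real.rpow_neg h3.le]
    have h5 : (1 + t) ^ (-(1 - α - 1)) = (1 + t) ^ (α - 1) * (1 + t) := by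
      rw [← Real.rpow_add_one h3.ne']; congr 1; ring
    rw [h5]
    have : 0 < (1 + t) ^ (α - 1) := by positivity
    field_simp
  rw [e2]
  have e3 : Complex.betaIntegral (α : ℂ) ((1 - α : ℝ) : ℂ)
      = ((∫ x in Ioo (0:ℝ) 1, x ^ (α - 1) * (1 - x) ^ ((1 - α) - 1) : ℝ) : ℂ) := by
    rw [Complex.betaIntegral, intervalIntegral.integral_of_le zero_le_one,
      integral_Ioc_eq_integral_Ioo, ← integral_complex_ofReal]
    apply setIntegral_congr_fun measurableSet_Ioo
    intro x hx
    have hx0 : 0 < x := hx.1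
    have hx1 : 0 < 1 - x := by linarith [hx.2]
    simp only
    rw [Complex.ofReal_mul, Complex.ofReal_cpow hx0.le, Complex.ofReal_cpow hx1.le]
    push_cast
    rfl
  have e4 := ProbabilityTheory.beta_eq_betaIntegralReal α (1 - α) h0 (by linarith)
  rw [e3, Complex.ofReal_re] at e4
  rw [← e4, ProbabilityTheory.beta, Real.Gamma_mul_Gamma_one_sub]
  simp

lemma sin_pos {α : ℝ} (h0 : 0 < α) (h1 : α < 1) : 0 < Real.sin (Real.pi * α) := by
  apply Real.sin_pos_of_pos_of_lt_pi
  · have := Real.pi_pos; positivity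
  · nlinarith [Real.pi_pos]

lemma int_of_bound {E : Type*} [NormedAddCommGroup E] [NormedSpace ℝ E] {α : ℝ} (h0 : 0 < α)
    (h1 : α < 1) {f : ℝ → E} (hf : ContinuousOn f (Ioi 0)) (C : ℝ)
    (h : ∀ t, 0 < t → ‖f t‖ ≤ C * (1 + t)⁻¹) :
    IntegrableOn (fun t : ℝ => (t ^ (α - 1) : ℝ) • f t) (Ioi 0) := by
  refine Integrable.mono' ((base_int h0 h1).const_mul C) ?_ ?_
  · apply ContinuousOn.aestronglyMeasurable _ measurableSet_Ioi
    exact (continuousOn_id.rpow_const fun x hx => Or.inl (ne_of_gt hx)).smul hf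
  · filter_upwards [ae_restrict_mem measurableSet_Ioi] with t ht
    have ht : 0 < t := ht
    rw [norm_smul, Real.norm_of_nonneg (by positivity)]
    calc t ^ (α - 1) * ‖f t‖ ≤ t ^ (α - 1) * (C * (1 + t)⁻¹) := by gcongr; exact h t ht
      _ = _ := by ring

lemma le_of_two {x a b t : ℝ} (ht : 0 < t) (h1 : x ≤ a) (h2 : x ≤ b / t) :
    x ≤ (a + b) * (1 + t)⁻¹ := by
  rw [← div_eq_mul_inv, le_div_iff₀ (by positivity)]
  rw [le_div_iff₀ ht] at h2
  linarith

set_option linter.unusedSectionVars false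
section algebra
variable {E : Type*} [NormedRing E] [NormedAlgebra ℂ E] [CompleteSpace E]

/-- resolvent `(t+T)⁻¹` -/
def res (T : E) (t : ℝ) : E := Ring.inverse (t • (1 : E) + T)

structure Sect (T : E) (M : ℝ) : Prop where
  pos : 0 ≤ M
  unit : ∀ t : ℝ, 0 < t → IsUnit (t • (1 : E) + T)
  bound : ∀ t : ℝ, 0 < t → ‖res T t‖ ≤ M / t

variable {T : E} {M : ℝ}

lemma Sect.mul_res (h : Sect T M) {t : ℝ} (ht : 0 < t) : (t • (1 : E) + T) * res T t = 1 :=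
  Ring.mul_inverse_cancel _ (h.unit t ht)

lemma Sect.res_mul (h : Sect T M) {t : ℝ} (ht : 0 < t) : res T t * (t • (1 : E) + T) = 1 :=
  Ring.inverse_mul_cancel _ (h.unit t ht)

lemma Sect.T_mul_res (h : Sect T M) {t : ℝ} (ht : 0 < t) : T * res T t = 1 - t • res T t := by
  have := h.mul_res ht
  rw [add_mul, smul_mul_assoc, one_mul] at this
  exact eq_sub_of_add_eq' this

lemma Sect.res_mul_T (h : Sect T M) {t : ℝ} (ht : 0 < t) : res T t * T = 1 - t • res T t := by
  have := h.res_mul ht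
  rw [mul_add, mul_smul_comm, mul_one] at this
  exact eq_sub_of_add_eq' this

lemma Sect.comm (h : Sect T M) {t : ℝ} (ht : 0 < t) : T * res T t = res T t * T := by
  rw [h.T_mul_res ht, h.res_mul_T ht]

lemma Sect.hasDerivAt (h : Sect T M) {t : ℝ} (ht : 0 < t) :
    HasDerivAt (res T) (-(res T t * res T t)) t := by
  obtain ⟨u, hu⟩ := h.unit t ht
  have h1 : HasDerivAt (fun t : ℝ => t • (1 : E) + T) 1 t := by
    simpa using ((hasDerivAt_id t).smul_const (1 : E)).add_const T
  have h2 := hasFDerivAt_ringInverse (𝕜 := ℝ) u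
  rw [hu] at h2
  have h3 := h2.comp_hasDerivAt t h1
  have h4 : res T t = ↑u⁻¹ := by rw [res, ← hu, Ring.inverse_unit]
  refine h3.congr_deriv ?_
  simp [h4]

lemma Sect.cont (h : Sect T M) : ContinuousOn (res T) (Ioi 0) := fun _ ht =>
  (h.hasDerivAt ht).continuousAt.continuousWithinAt

lemma Sect.bound1 (h : Sect T M) {t : ℝ} (ht : 0 < t) : ‖t • res T t‖ ≤ M := by
  rw [norm_smul, Real.norm_of_nonneg ht.le]
  have := h.bound t ht
  rwa [le_div_iff₀' ht] at this

lemma Sect.bound2 (h : Sect T M) {t : ℝ} (ht : 0 < t) : ‖T * res T t‖ ≤ ‖(1 : E)‖ + M := by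
  rw [h.T_mul_res ht]
  exact (norm_sub_le _ _).trans (by gcongr; exact h.bound1 ht)

/-- `∫ t^(α-1) (t+s+T)⁻¹ dt` -/
def G (T : E) (α s : ℝ) : E := ∫ t in Ioi (0 : ℝ), (t ^ (α - 1) : ℝ) • res T (t + s)

lemma Sect.cont_shift (h : Sect T M) {s : ℝ} (hs : 0 ≤ s) :
    ContinuousOn (fun t => res T (t + s)) (Ioi 0) := by
  apply h.cont.comp (by fun_prop)
  intro t ht
  have : (0 : ℝ) < t := ht
  show 0 < t + s
  linarith

lemma Sect.bound_shift (h : Sect T M) {s t : ℝ} (hs : 0 < s) (ht : 0 < t) :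
    ‖res T (t + s)‖ ≤ (M / s + M) * (1 + t)⁻¹ := by
  have h1 := h.bound (t + s) (by linarith)
  have hM := h.pos
  apply le_of_two ht
  · exact h1.trans (by gcongr; linarith)
  · exact h1.trans (by gcongr; linarith)

lemma G_int (h : Sect T M) {α s : ℝ} (h0 : 0 < α) (h1 : α < 1) (hs : 0 < s) :
    IntegrableOn (fun t : ℝ => (t ^ (α - 1) : ℝ) • res T (t + s)) (Ioi 0) :=
  int_of_bound h0 h1 (h.cont_shift hs.le) _ fun _ ht => h.bound_shift hs ht

lemma Sect.bound_sq (h : Sect T M) {s u t : ℝ} (hs : 0 < s) (hu : s ≤ u) (ht : 0 < t) :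
    ‖res T (t + u) * res T (t + u)‖ ≤ ((M / s + M) * (M / s)) * (1 + t)⁻¹ := by
  have hM := h.pos
  have hu0 : 0 < u := lt_of_lt_of_le hs hu
  calc _ ≤ ‖res T (t + u)‖ * ‖res T (t + u)‖ := norm_mul_le _ _
    _ ≤ ((M / u + M) * (1 + t)⁻¹) * (M / (t + u)) := by
        gcongr
        · exact h.bound_shift hu0 ht
        · exact h.bound _ (by linarith)
    _ ≤ ((M / s + M) * (1 + t)⁻¹) * (M / s) := by
        gcongr
        linarith
    _ = _ := by ring

lemma G_sq_int (h : Sect T M) {α s : ℝ} (h0 : 0 < α) (h1 : α < 1) (hs : 0 < s) :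
    IntegrableOn (fun t : ℝ => (t ^ (α - 1) : ℝ) • (res T (t + s) * res T (t + s))) (Ioi 0) :=
  int_of_bound h0 h1 ((h.cont_shift hs.le).mul (h.cont_shift hs.le)) _
    fun _ ht => h.bound_sq hs le_rfl ht

lemma G_hasDeriv (h : Sect T M) {α s : ℝ} (h0 : 0 < α) (h1 : α < 1) (hs : 0 < s) :
    HasDerivAt (G T α)
      (-∫ t in Ioi (0 : ℝ), (t ^ (α - 1) : ℝ) • (res T (t + s) * res T (t + s))) s := by
  have hs2 : 0 < s / 2 := by positivity
  have hN : Ioi (s / 2) ∈ nhds s := Ioi_mem_nhds (by linarith)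
  have key := (hasDerivAt_integral_of_dominated_loc_of_deriv_le
    (μ := volume.restrict (Ioi (0:ℝ))) (F := fun s t => (t ^ (α - 1) : ℝ) • res T (t + s))
    (F' := fun s t => (t ^ (α - 1) : ℝ) • -(res T (t + s) * res T (t + s)))
    (bound := fun t => ((M / (s/2) + M) * (M / (s/2))) * (t ^ (α - 1) * (1 + t)⁻¹))
    (x₀ := s) (s := Ioi (s / 2)) hN ?_ (G_int h h0 h1 hs) ?_ ?_ ?_ ?_).2
  · rw [← integral_neg]
    simp only [smul_neg] at key
    exact key
  · filter_upwards [hN] with u hu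
    exact (G_int h h0 h1 (lt_trans hs2 hu)).aestronglyMeasurable
  · have := (G_sq_int h h0 h1 hs).aestronglyMeasurable.neg
    refine this.congr (ae_of_all _ fun t => ?_)
    simp
  · filter_upwards [ae_restrict_mem measurableSet_Ioi] with t ht u hu
    have ht : 0 < t := ht
    rw [norm_smul, norm_neg, Real.norm_of_nonneg (by positivity)]
    calc _ ≤ t ^ (α - 1) * (((M / (s/2) + M) * (M / (s/2))) * (1 + t)⁻¹) := by
            gcongr; exact h.bound_sq hs2 (le_of_lt hu) ht
      _ = _ := by ring
  · exact (base_int h0 h1).const_mul _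
  · filter_upwards [ae_restrict_mem measurableSet_Ioi] with t ht u hu
    have ht : 0 < t := ht
    have hu : s / 2 < u := hu
    have e1 := h.hasDerivAt (t := t + u) (by linarith)
    have e2 : HasDerivAt (fun u => res T (t + u)) (-(res T (t + u) * res T (t + u))) u := by
      simpa using e1.comp_const_add t u
    exact e2.const_smul _

lemma G_ibp (h : Sect T M) {α s : ℝ} (h0 : 0 < α) (h1 : α < 1) (hs : 0 < s) :
    (s • (1 : E) + T) * (∫ t in Ioi (0 : ℝ), (t ^ (α - 1) : ℝ) • (res T (t + s) * res T (t + s)))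
      = (1 - α) • G T α s := by
  have hM := h.pos
  have ptw : ∀ t : ℝ, 0 < t → (s • (1 : E) + T) * ((t ^ (α - 1) : ℝ) • (res T (t + s) * res T (t + s)))
      = (t ^ (α - 1) : ℝ) • res T (t + s) - (t ^ α : ℝ) • (res T (t + s) * res T (t + s)) := by
    intro t ht
    have e := h.mul_res (t := t + s) (by linarith)
    have e2 : (s • (1 : E) + T) * res T (t + s) = 1 - t • res T (t + s) := by
      rw [eq_sub_iff_add_eq]; refine Eq.trans ?_ e; simp only [add_mul, add_smul, smul_mul_assoc, one_mul]; abel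
    rw [mul_smul_comm, ← mul_assoc, e2, sub_mul, one_mul, smul_sub, smul_mul_assoc, smul_smul,
      ← Real.rpow_add_one ht.ne']
    simp
  have hsq := G_sq_int h h0 h1 hs
  have hG := G_int h h0 h1 hs
  have hprod : IntegrableOn (fun t : ℝ => (s • (1 : E) + T) * ((t ^ (α - 1) : ℝ) • (res T (t + s) * res T (t + s)))) (Ioi 0) :=
    hsq.const_mul _
  have h3 : IntegrableOn (fun t : ℝ => (t ^ α : ℝ) • (res T (t + s) * res T (t + s))) (Ioi 0) := by
    refine (hG.sub hprod).congr_fun ?_ measurableSet_Ioi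
    intro t ht
    simp only [Pi.sub_apply]
    rw [ptw t ht]; abel
  have ibp : ∫ t in Ioi (0:ℝ), (α • ((t ^ (α - 1) : ℝ) • res T (t + s)) - (t ^ α : ℝ) • (res T (t + s) * res T (t + s))) = 0 := by
    have := integral_Ioi_of_hasDerivAt_of_tendsto (a := (0:ℝ)) (m := (0 : E))
      (f := fun t => (t ^ α : ℝ) • res T (t + s))
      (f' := fun t => (α • ((t ^ (α - 1) : ℝ) • res T (t + s)) - (t ^ α : ℝ) • (res T (t + s) * res T (t + s))))
      ?_ ?_ ?_ ?_
    · rw [this]; simp [Real.zero_rpow h0.ne']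
    · apply ContinuousAt.continuousWithinAt
      refine ContinuousAt.smul (f := fun t : ℝ => t ^ α) ?_ ?_
      · exact Real.continuousAt_rpow_const _ _ (Or.inr h0.le)
      · have := (h.hasDerivAt hs).continuousAt
        apply ContinuousAt.comp (g := res T)
        · simpa using this
        · fun_prop
    · intro t ht
      have ht : 0 < t := ht
      have e1 := (h.hasDerivAt (t := t + s) (by linarith)).comp_add_const t s
      have e2 := Real.hasDerivAt_rpow_const (x := t) (p := α) (Or.inl ht.ne')
      refine (e2.smul e1).congr_deriv ?_
      simp [smul_smul]
      abel
    · exact (hG.smul α).sub h3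
    · apply squeeze_zero_norm' (a := fun t : ℝ => M * t ^ (α - 1))
      · filter_upwards [eventually_gt_atTop 0] with t ht
        rw [norm_smul, Real.norm_of_nonneg (by positivity)]
        calc t ^ α * ‖res T (t + s)‖ ≤ t ^ α * (M / t) := by
              gcongr
              exact (h.bound (t + s) (by linarith)).trans (by gcongr; linarith)
          _ = M * t ^ (α - 1) := by
              rw [Real.rpow_sub_one ht.ne']; ring
      · have := tendsto_rpow_neg_atTop (y := 1 - α) (by linarith)
        simpa [neg_sub] using this.const_mul M
  have hG' : IntegrableOn (fun t : ℝ => α • ((t ^ (α - 1) : ℝ) • res T (t + s))) (Ioi 0) := hG.smul α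
  rw [integral_sub hG' h3, integral_smul, sub_eq_zero] at ibp
  rw [← integral_const_mul_of_integrable hsq]
  rw [setIntegral_congr_fun measurableSet_Ioi (fun t ht => ptw t ht), integral_sub hG h3, ← ibp,
    sub_smul, one_smul]
  rfl

end algebra
end FracAux
end

noncomputable section
namespace FracAux
set_option linter.unusedSectionVars false
section algebra
variable {E : Type*} [NormedRing E] [NormedAlgebra ℂ E] [CompleteSpace E] {T : E} {M : ℝ}

lemma bic_res (S : Set E) (hT : T ∈ bic S) (t : ℝ) : res T t ∈ bic S := by
  apply bic_inverse
  refine add_mem ?_ hT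
  rw [← Complex.coe_smul]
  exact Subalgebra.smul_mem _ (one_mem _) _

lemma bic_rsmul {S : Set E} {x : E} (hx : x ∈ bic S) (t : ℝ) : t • x ∈ bic S := by
  rw [← Complex.coe_smul]
  exact Subalgebra.smul_mem _ hx _

lemma bic_comm {S : Set E} (hS : ∀ x ∈ S, ∀ y ∈ S, x * y = y * x) {x y : E} (hx : x ∈ bic S)
    (hy : y ∈ bic S) : x * y = y * x :=
  Set.centralizer_centralizer_comm_of_comm hS _ hx _ hy

lemma bic_comm1 {T x y : E} (hx : x ∈ bic {T}) (hy : y ∈ bic {T}) : x * y = y * x :=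
  bic_comm (by simp) hx hy

lemma bic_self (T : E) : T ∈ bic {T} := bic_of_mem rfl

lemma bic_G {S : Set E} (hT : T ∈ bic S) (α s : ℝ) : G T α s ∈ bic S := by
  apply bic_integral measurableSet_Ioi
  intro t _
  exact bic_rsmul (bic_res S hT _) _

lemma G_hasDeriv' (h : Sect T M) {α s : ℝ} (h0 : 0 < α) (h1 : α < 1) (hs : 0 < s) :
    ∃ D ∈ bic {T}, HasDerivAt (G T α) D s ∧ (s • (1 : E) + T) * D = -((1 - α) • G T α s) := by
  refine ⟨_, ?_, G_hasDeriv h h0 h1 hs, ?_⟩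
  · apply neg_mem
    apply bic_integral measurableSet_Ioi
    intro t _
    exact bic_rsmul (mul_mem (bic_res _ (bic_self T) _) (bic_res _ (bic_self T) _)) _
  · rw [mul_neg, G_ibp h h0 h1 hs]

lemma GG_const (h : Sect T M) {α : ℝ} (h0 : 0 < α) (h1 : α < 1) {s s' : ℝ} (hs : 0 < s)
    (hs' : 0 < s') : (s • (1 : E) + T) * (G T α s * G T (1 - α) s)
      = (s' • (1 : E) + T) * (G T α s' * G T (1 - α) s') := by
  have hd : ∀ s : ℝ, 0 < s → HasDerivAt
      (fun s : ℝ => (s • (1 : E) + T) * (G T α s * G T (1 - α) s)) 0 s := by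
    intro s hs
    obtain ⟨D, hD, d1, e1⟩ := G_hasDeriv' h h0 h1 hs
    obtain ⟨D', hD', d2, e2⟩ := G_hasDeriv' h (α := 1 - α) (by linarith) (by linarith) hs
    have d0 : HasDerivAt (fun t : ℝ => t • (1 : E) + T) 1 s := by
      simpa using ((hasDerivAt_id s).smul_const (1 : E)).add_const T
    refine (d0.mul (d1.mul d2)).congr_deriv ?_
    have hg := bic_G (bic_self T) α s
    have hg' := bic_G (bic_self T) (1 - α) s
    rw [mul_add, ← mul_assoc, e1, bic_comm1 hg hD', ← mul_assoc, e2, neg_mul, neg_mul,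
      smul_mul_assoc, smul_mul_assoc, bic_comm1 hg' hg]
    rw [Pi.mul_apply, sub_sub_cancel, sub_smul, one_smul, one_mul]
    abel
  apply IsOpen.is_const_of_deriv_eq_zero (𝕜 := ℝ)
    (f := fun s : ℝ => (s • (1 : E) + T) * (G T α s * G T (1 - α) s)) (s := Ioi 0) isOpen_Ioi
    isPreconnected_Ioi
  · intro s hs
    exact (hd s hs).differentiableAt.differentiableWithinAt
  · intro s hs
    exact (hd s hs).deriv
  · exact hs
  · exact hs'

lemma res_limit (h : Sect T M) : Tendsto (fun v : ℝ => v • res T v) atTop (nhds 1) := by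
  have h1 : Tendsto (fun v : ℝ => T * res T v) atTop (nhds 0) := by
    apply squeeze_zero_norm' (a := fun v : ℝ => ‖T‖ * M * v⁻¹)
    · filter_upwards [eventually_gt_atTop 0] with v hv
      calc _ ≤ ‖T‖ * ‖res T v‖ := norm_mul_le _ _
        _ ≤ ‖T‖ * (M / v) := by gcongr; exact h.bound v hv
        _ = _ := by ring
    · simpa using tendsto_inv_atTop_zero.const_mul (‖T‖ * M)
  have h2 : Tendsto (fun v : ℝ => 1 - T * res T v) atTop (nhds (1 - 0)) := h1.const_sub 1
  rw [sub_zero] at h2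
  apply h2.congr'
  filter_upwards [eventually_gt_atTop 0] with v hv
  rw [h.T_mul_res hv]; abel

lemma G_scale {α s : ℝ} (hs : 0 < s) : s ^ (1 - α) • G T α s
      = ∫ u in Ioi (0 : ℝ), (u ^ (α - 1) : ℝ) • (s • res T (s * (u + 1))) := by
  have := integral_comp_mul_left_Ioi (fun t : ℝ => (t ^ (α - 1) : ℝ) • res T (t + s)) 0 hs
  rw [mul_zero] at this
  have e : G T α s = s • ∫ x in Ioi (0:ℝ), ((s * x) ^ (α - 1) : ℝ) • res T (s * x + s) := by
    rw [this, smul_smul, mul_inv_cancel₀ hs.ne', one_smul]; rfl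
  rw [e, ← integral_smul, ← integral_smul]
  apply setIntegral_congr_fun measurableSet_Ioi
  intro u hu
  have hu : 0 < u := hu
  simp only [smul_smul]
  rw [Real.mul_rpow hs.le hu.le, mul_add, mul_one]
  congr 1
  have : s ^ (1 - α) * s ^ (α - 1) = 1 := by
    rw [← Real.rpow_add hs]; simp
  linear_combination s * u ^ (α - 1) * this

lemma G_limit (h : Sect T M) {α : ℝ} (h0 : 0 < α) (h1 : α < 1) :
    Tendsto (fun s : ℝ => s ^ (1 - α) • G T α s) atTop
      (nhds ((Real.pi / Real.sin (Real.pi * α)) • (1 : E))) := by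
  have e : (Real.pi / Real.sin (Real.pi * α)) • (1 : E)
      = ∫ u in Ioi (0 : ℝ), (u ^ (α - 1) : ℝ) • ((1 + u)⁻¹ • (1 : E)) := by
    simp only [smul_smul]
    rw [integral_smul_const, integral_base h0 h1]
  rw [e]
  have : Tendsto (fun s : ℝ => ∫ u in Ioi (0 : ℝ), (u ^ (α - 1) : ℝ) • (s • res T (s * (u + 1)))) atTop
      (nhds (∫ u in Ioi (0 : ℝ), (u ^ (α - 1) : ℝ) • ((1 + u)⁻¹ • (1 : E)))) := by
    have bd : ∀ s : ℝ, 0 < s → ∀ u : ℝ, 0 < u → ‖s • res T (s * (u + 1))‖ ≤ M * (1 + u)⁻¹ := by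
      intro s hs u hu
      rw [norm_smul, Real.norm_of_nonneg hs.le]
      calc _ ≤ s * (M / (s * (u + 1))) := by gcongr; exact h.bound _ (by positivity)
        _ = _ := by field_simp; ring
    apply tendsto_integral_filter_of_dominated_convergence (fun t => M * (t ^ (α - 1) * (1 + t)⁻¹))
    · filter_upwards [eventually_gt_atTop 0] with s hs
      apply (int_of_bound h0 h1 _ M (bd s hs)).aestronglyMeasurable
      apply ContinuousOn.const_smul
      apply h.cont.comp (by fun_prop)
      intro u hu
      have : (0:ℝ) < u := hu
      show 0 < s * (u + 1)
      positivity
    · filter_upwards [eventually_gt_atTop 0] with s hs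
      filter_upwards [ae_restrict_mem measurableSet_Ioi] with t ht
      have ht : 0 < t := ht
      rw [norm_smul, Real.norm_of_nonneg (by positivity)]
      calc _ ≤ t ^ (α - 1) * (M * (1 + t)⁻¹) := by gcongr; exact bd s hs t ht
        _ = _ := by ring
    · exact (base_int h0 h1).const_mul _
    · filter_upwards [ae_restrict_mem measurableSet_Ioi] with u hu
      have hu : 0 < u := hu
      apply Tendsto.const_smul
      have t1 : Tendsto (fun s : ℝ => s * (u + 1)) atTop atTop :=
        tendsto_id.atTop_mul_const (by positivity)
      have t2 := ((res_limit h).comp t1).const_smul ((1 + u)⁻¹)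
      refine t2.congr fun s => ?_
      simp only [Function.comp, smul_smul]
      congr 1
      field_simp; ring
  apply this.congr'
  filter_upwards [eventually_gt_atTop 0] with s hs
  rw [G_scale hs]

lemma GG_eq (h : Sect T M) {α : ℝ} (h0 : 0 < α) (h1 : α < 1) {s : ℝ} (hs : 0 < s) :
    (s • (1 : E) + T) * (G T α s * G T (1 - α) s)
      = ((Real.pi / Real.sin (Real.pi * α)) * (Real.pi / Real.sin (Real.pi * α))) • (1 : E) := by
  have l1 := G_limit h h0 h1
  have l2 := G_limit h (α := 1 - α) (by linarith) (by linarith)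
  have hsin : Real.sin (Real.pi * (1 - α)) = Real.sin (Real.pi * α) := by
    rw [mul_sub, mul_one, Real.sin_pi_sub]
  rw [hsin, sub_sub_cancel] at l2
  have l3 : Tendsto (fun s : ℝ => (1 : E) + s⁻¹ • T) atTop (nhds ((1 : E) + (0:ℝ) • T)) :=
    (tendsto_inv_atTop_zero.smul_const T).const_add 1
  have l4 := l3.mul (l1.mul l2)
  have l5 : Tendsto (fun _ : ℝ => (s • (1 : E) + T) * (G T α s * G T (1 - α) s)) atTop
      (nhds ((1 + (0:ℝ) • T) * ((Real.pi / Real.sin (Real.pi * α)) • (1 : E) * (Real.pi / Real.sin (Real.pi * α)) • (1 : E)))) := by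
    apply l4.congr'
    filter_upwards [eventually_gt_atTop 0] with u hu
    rw [GG_const h h0 h1 hs hu]
    simp only [smul_mul_assoc, mul_smul_comm, add_mul, one_mul, smul_add, smul_smul]
    have e1 : u ^ α * u ^ (1 - α) = u := by rw [← Real.rpow_add hu]; simp
    have e1' : u ^ (1 - α) * u ^ α = u := by rw [← Real.rpow_add hu]; simp
    have e2 : u * u⁻¹ = 1 := mul_inv_cancel₀ hu.ne'
    simp [e1, e1', e2, mul_assoc]
  rw [tendsto_nhds_unique tendsto_const_nhds l5]
  simp [smul_smul]

/-- Balakrishnan integral in a Banach algebra -/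
def Bal (T : E) (α : ℝ) : E :=
  (Real.sin (Real.pi * α) / Real.pi) •
    ∫ t in Ioi (0 : ℝ), (t ^ (α - 1) : ℝ) • (T * res T t)

lemma bic_Bal {S : Set E} (hT : T ∈ bic S) (α : ℝ) : Bal T α ∈ bic S := by
  apply bic_rsmul
  apply bic_integral measurableSet_Ioi
  intro t _
  exact bic_rsmul (mul_mem hT (bic_res S hT _)) _

lemma Sect.bound3 (h : Sect T M) {t : ℝ} (ht : 0 < t) :
    ‖T * res T t‖ ≤ ((‖(1 : E)‖ + M) + ‖T‖ * M) * (1 + t)⁻¹ := by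
  apply le_of_two ht (h.bound2 ht)
  calc _ ≤ ‖T‖ * ‖res T t‖ := norm_mul_le _ _
    _ ≤ ‖T‖ * (M / t) := by gcongr; exact h.bound t ht
    _ = _ := by ring

lemma Bal_int (h : Sect T M) {α : ℝ} (h0 : 0 < α) (h1 : α < 1) :
    IntegrableOn (fun t : ℝ => (t ^ (α - 1) : ℝ) • (T * res T t)) (Ioi 0) :=
  int_of_bound h0 h1 (continuousOn_const.mul h.cont) _ fun _ ht => h.bound3 ht

lemma F_limit (h : Sect T M) {α : ℝ} (h0 : 0 < α) (h1 : α < 1) :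
    Tendsto (fun s : ℝ => (s • (1 : E) + T) * G T α s) (nhdsWithin 0 (Ioi 0))
      (nhds (∫ t in Ioi (0 : ℝ), (t ^ (α - 1) : ℝ) • (T * res T t))) := by
  have hM := h.pos
  have hlt : ∀ᶠ s : ℝ in nhdsWithin 0 (Ioi 0), 0 < s ∧ s < 1 :=
    Ioo_mem_nhdsGT one_pos
  have bd : ∀ s : ℝ, 0 < s → s < 1 → ∀ t, 0 < t → ‖(s • (1 : E) + T) * res T (t + s)‖
      ≤ ((‖(1 : E)‖ + M) + (‖(1 : E)‖ + ‖T‖) * M) * (1 + t)⁻¹ := by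
    intro s hs hs1 t ht
    apply le_of_two ht
    · have e := h.mul_res (t := t + s) (by linarith)
      have e2 : (s • (1 : E) + T) * res T (t + s) = 1 - t • res T (t + s) := by
        rw [eq_sub_iff_add_eq]; refine Eq.trans ?_ e
        simp only [add_mul, add_smul, smul_mul_assoc, one_mul]; abel
      rw [e2]
      refine (norm_sub_le _ _).trans ?_
      gcongr
      rw [norm_smul, Real.norm_of_nonneg ht.le]
      calc _ ≤ t * (M / (t + s)) := by gcongr; exact h.bound _ (by linarith)
        _ ≤ t * (M / t) := by gcongr; linarith
        _ = M := by field_simp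
    · calc _ ≤ ‖s • (1 : E) + T‖ * ‖res T (t + s)‖ := norm_mul_le _ _
        _ ≤ (‖(1 : E)‖ + ‖T‖) * (M / t) := by
          gcongr
          · refine (norm_add_le _ _).trans ?_
            gcongr
            rw [norm_smul, Real.norm_of_nonneg hs.le]
            exact mul_le_of_le_one_left (norm_nonneg _) hs1.le
          · exact (h.bound _ (by linarith)).trans (by gcongr; linarith)
        _ = _ := by ring
  have : Tendsto (fun s : ℝ => ∫ t in Ioi (0 : ℝ), (t ^ (α - 1) : ℝ) • ((s • (1 : E) + T) * res T (t + s)))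
      (nhdsWithin 0 (Ioi 0))
      (nhds (∫ t in Ioi (0 : ℝ), (t ^ (α - 1) : ℝ) • (T * res T t))) := by
    apply tendsto_integral_filter_of_dominated_convergence
      (fun t => ((‖(1 : E)‖ + M) + (‖(1 : E)‖ + ‖T‖) * M) * (t ^ (α - 1) * (1 + t)⁻¹))
    · filter_upwards [hlt] with s hs
      exact (int_of_bound h0 h1 (continuousOn_const.mul (h.cont_shift hs.1.le)) _
        (bd s hs.1 hs.2)).aestronglyMeasurable
    · filter_upwards [hlt] with s hs
      filter_upwards [ae_restrict_mem measurableSet_Ioi] with t ht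
      have ht : 0 < t := ht
      rw [norm_smul, Real.norm_of_nonneg (by positivity)]
      calc _ ≤ t ^ (α - 1) * (((‖(1 : E)‖ + M) + (‖(1 : E)‖ + ‖T‖) * M) * (1 + t)⁻¹) := by
            gcongr; exact bd s hs.1 hs.2 t ht
        _ = _ := by ring
    · exact (base_int h0 h1).const_mul _
    · filter_upwards [ae_restrict_mem measurableSet_Ioi] with t ht
      have ht : 0 < t := ht
      apply Tendsto.const_smul
      have c1 : ContinuousAt (fun s : ℝ => (s • (1 : E) + T) * res T (t + s)) 0 := by
        apply ContinuousAt.mul (by fun_prop)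
        apply ContinuousAt.comp (g := res T)
        · simpa using (h.hasDerivAt ht).continuousAt
        · fun_prop
      have c2 := c1.tendsto.mono_left (nhdsWithin_le_nhds (s := Ioi 0))
      simpa using c2
  apply this.congr'
  filter_upwards [hlt] with s hs
  rw [G, ← integral_const_mul_of_integrable (G_int h h0 h1 hs.1)]
  simp only [mul_smul_comm]

lemma Bal_mul (h : Sect T M) {α : ℝ} (h0 : 0 < α) (h1 : α < 1) :
    Bal T α * Bal T (1 - α) = T := by
  have l := (F_limit h h0 h1).mul (F_limit h (α := 1 - α) (by linarith) (by linarith))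
  have hsin : Real.sin (Real.pi * (1 - α)) = Real.sin (Real.pi * α) := by
    rw [mul_sub, mul_one, Real.sin_pi_sub]
  have hs0 := sin_pos h0 h1
  set k := (Real.pi / Real.sin (Real.pi * α)) * (Real.pi / Real.sin (Real.pi * α)) with hk
  have c1 : Tendsto (fun s : ℝ => k • (s • (1 : E) + T)) (nhdsWithin 0 (Ioi 0)) (nhds (k • ((0:ℝ) • (1 : E) + T))) :=
    (Continuous.tendsto (by fun_prop) 0).mono_left nhdsWithin_le_nhds
  have l2 := tendsto_nhds_unique (c1.congr' (by
    filter_upwards [self_mem_nhdsWithin] with s hs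
    have hT : (s • (1 : E) + T) ∈ bic {T} :=
      add_mem (bic_rsmul (one_mem _) _) (bic_self T)
    have e := GG_eq h h0 h1 hs
    have hg := bic_G (bic_self T) α s
    have hg' := bic_G (bic_self T) (1 - α) s
    calc k • (s • (1 : E) + T) = (s • (1 : E) + T) * ((s • (1 : E) + T) * (G T α s * G T (1 - α) s)) := by
          rw [e, mul_smul_comm, mul_one]
      _ = ((s • (1 : E) + T) * G T α s) * ((s • (1 : E) + T) * G T (1 - α) s) := by
          rw [← mul_assoc _ (G T α s), bic_comm1 hT hg]
          simp only [← mul_assoc]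
          rw [bic_comm1 hT hg])) l
  rw [zero_smul, zero_add] at l2
  rw [Bal, Bal, hsin, smul_mul_smul_comm, ← l2, smul_smul, hk]
  have : Real.pi ≠ 0 := Real.pi_ne_zero
  convert one_smul ℝ T using 2
  field_simp

end algebra
end FracAux
end

noncomputable section
namespace FracAux
set_option linter.unusedSectionVars false
section algebra
variable {E : Type*} [NormedRing E] [NormedAlgebra ℂ E] [CompleteSpace E] {T : E} {M : ℝ}

lemma scal_id {b g : ℂ} {t : ℝ} (hb : b ≠ 0) (hg : g * (t + b) = b) :
    g = ((‖g‖ ^ 2 : ℝ) : ℂ) + (((t / ‖b‖ ^ 2) * ‖g‖ ^ 2 : ℝ) : ℂ) * b := by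
  have hb2 : ((‖b‖ : ℝ) : ℂ) ^ 2 ≠ 0 := by simpa using hb
  have e1 : ((‖b‖ : ℝ) : ℂ) ^ 2 = b * (starRingEnd ℂ) b := by rw [Complex.mul_conj']
  have e2 : ((‖g‖ : ℝ) : ℂ) ^ 2 = g * (starRingEnd ℂ) g := by rw [Complex.mul_conj']
  have hg' : (starRingEnd ℂ) g * (t + (starRingEnd ℂ) b) = (starRingEnd ℂ) b := by
    simpa using congrArg (starRingEnd ℂ) hg
  have hb3 : (starRingEnd ℂ) b ≠ 0 := by simpa using hb
  push_cast
  rw [e1, e2]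
  field_simp
  linear_combination (-g * hg')

lemma coneVal_Bal (h : Sect T M) {S : Set E} (hT : T ∈ bic S) {φ : E →L[ℂ] ℂ}
    (hφ : IsChar S φ) {α : ℝ} (h0 : 0 < α) (h1 : α < 1) : ConeVal (φ T) (φ (Bal T α)) := by
  set b := φ T with hbdef
  set c := Real.sin (Real.pi * α) / Real.pi with hc
  have hcpos : 0 < c := div_pos (sin_pos h0 h1) Real.pi_pos
  set g : ℝ → ℂ := fun t => φ (T * res T t) with hgdef
  have hg : ∀ t : ℝ, 0 < t → g t * (t + b) = b := by
    intro t ht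
    have e : φ (T * res T t * (t • (1:E) + T)) = g t * (t + b) := by
      rw [hφ.mul _ (mul_mem hT (bic_res S hT t)) _ (add_mem (bic_rsmul (one_mem _) _) hT),
        map_add, ← Complex.coe_smul, hφ.algebraMap_re]
    rw [← e, mul_assoc, h.res_mul ht, mul_one]
  have hval : φ (Bal T α) = c • ∫ t in Ioi (0:ℝ), (t ^ (α - 1) : ℝ) • g t := by
    rw [Bal, ← hc, ← Complex.coe_smul, map_smul, Complex.coe_smul,
      ← φ.integral_comp_comm (Bal_int h h0 h1)]
    congr 2
    ext t
    rw [← Complex.coe_smul, map_smul, Complex.coe_smul]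
  obtain ⟨C, hC⟩ : ∃ C : ℝ, ∀ t : ℝ, 0 < t → ‖g t‖ ≤ C * (1 + t)⁻¹ := by
    refine ⟨‖φ‖ * ((‖(1 : E)‖ + M) + ‖T‖ * M), fun t ht => ?_⟩
    calc _ ≤ ‖φ‖ * ‖T * res T t‖ := φ.le_opNorm _
      _ ≤ _ := by rw [mul_assoc]; gcongr; exact h.bound3 ht
  have hgc : ContinuousOn g (Ioi 0) :=
    φ.continuous.comp_continuousOn (continuousOn_const.mul h.cont)
  constructor
  · by_cases hb : b = 0
    · refine ⟨0, 0, le_rfl, le_rfl, ?_, fun h => absurd hb h⟩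
      rw [hval]
      have : ∫ t in Ioi (0:ℝ), (t ^ (α - 1) : ℝ) • g t = ∫ t in Ioi (0:ℝ), (0:ℂ) := by
        apply setIntegral_congr_fun measurableSet_Ioi
        intro t ht
        have := hg t ht
        rw [hb, add_zero] at this
        have ht' : (t:ℂ) ≠ 0 := by exact_mod_cast (ne_of_gt ht)
        have : g t = 0 := by simpa [ht'] using this
        simp [this]
      rw [this]; simp
    · have hg0 : ∀ t : ℝ, 0 < t → g t ≠ 0 := by
        intro t ht h'
        have := hg t ht
        rw [h', zero_mul] at this
        exact hb this.symm
      have hC0 : 0 ≤ C := by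
        have := (norm_nonneg _).trans (hC 1 one_pos)
        norm_num at this; linarith
      have i1 : IntegrableOn (fun t : ℝ => (t ^ (α - 1) : ℝ) • (‖g t‖ ^ 2)) (Ioi 0) := by
        refine int_of_bound h0 h1 (hgc.norm.pow 2) (C ^ 2) fun t ht => ?_
        have h3 : (1 + t)⁻¹ ≤ 1 := inv_le_one_of_one_le₀ (by linarith)
        have h4 : 0 ≤ (1 + t)⁻¹ := by positivity
        rw [Real.norm_of_nonneg (by positivity)]
        calc ‖g t‖ ^ 2 ≤ (C * (1 + t)⁻¹) ^ 2 := by gcongr; exact hC t ht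
          _ = C ^ 2 * ((1 + t)⁻¹ * (1 + t)⁻¹) := by ring
          _ ≤ C ^ 2 * ((1 + t)⁻¹ * 1) := by gcongr
          _ = _ := by ring
      have i2 : IntegrableOn (fun t : ℝ => (t ^ (α - 1) : ℝ) • ((t / ‖b‖ ^ 2) * ‖g t‖ ^ 2))
          (Ioi 0) := by
        refine int_of_bound h0 h1 ((continuousOn_id.div_const _).mul (hgc.norm.pow 2))
          (C ^ 2 / ‖b‖ ^ 2) fun t ht => ?_
        have h4 : 0 ≤ (1 + t)⁻¹ := by positivity
        have h3 : t * (1 + t)⁻¹ ≤ 1 := by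
          rw [← div_eq_mul_inv, div_le_one (by positivity)]; linarith
        rw [Real.norm_of_nonneg (by positivity)]
        calc t / ‖b‖ ^ 2 * ‖g t‖ ^ 2 ≤ t / ‖b‖ ^ 2 * (C * (1 + t)⁻¹) ^ 2 := by
              gcongr; exact hC t ht
          _ = C ^ 2 / ‖b‖ ^ 2 * ((t * (1 + t)⁻¹) * (1 + t)⁻¹) := by ring
          _ ≤ C ^ 2 / ‖b‖ ^ 2 * (1 * (1 + t)⁻¹) := by gcongr
          _ = _ := by ring
      set X := ∫ t in Ioi (0:ℝ), (t ^ (α - 1) : ℝ) • (‖g t‖ ^ 2) with hX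
      set Y := ∫ t in Ioi (0:ℝ), (t ^ (α - 1) : ℝ) • ((t / ‖b‖ ^ 2) * ‖g t‖ ^ 2) with hY
      have X0 : 0 < X := by
        rw [hX, setIntegral_pos_iff_support_of_nonneg_ae]
        · have : (Function.support fun t : ℝ => (t ^ (α - 1) : ℝ) • (‖g t‖ ^ 2)) ∩ Ioi 0
              = Ioi 0 := by
            apply inter_eq_right.2
            intro t ht
            have h5 : 0 < t ^ (α - 1) := Real.rpow_pos_of_pos ht _
            have h6 := norm_pos_iff.2 (hg0 t ht)
            have : 0 < (t ^ (α - 1) : ℝ) • (‖g t‖ ^ 2) := by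
              rw [smul_eq_mul]; positivity
            exact ne_of_gt this
          rw [this]; simp
        · filter_upwards [ae_restrict_mem measurableSet_Ioi] with t ht
          have h5 : 0 < t ^ (α - 1) := Real.rpow_pos_of_pos ht _
          simp only [smul_eq_mul, Pi.zero_apply]; positivity
        · exact i1
      have Y0 : 0 ≤ Y := by
        apply setIntegral_nonneg measurableSet_Ioi
        intro t ht
        have h5 : 0 < t ^ (α - 1) := Real.rpow_pos_of_pos ht _
        have ht' : 0 < t := ht
        simp only [smul_eq_mul]; positivity
      refine ⟨c * X, c * Y, by positivity, by positivity, ?_, fun _ => by positivity⟩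
      rw [hval]
      have : ∫ t in Ioi (0:ℝ), (t ^ (α - 1) : ℝ) • g t = (X : ℂ) + Y * b := by
        rw [hX, hY, ← integral_complex_ofReal, ← integral_complex_ofReal, ← integral_mul_const, ← integral_add]
        · apply setIntegral_congr_fun measurableSet_Ioi
          intro t ht
          have := scal_id hb (hg t ht)
          simp only [smul_eq_mul]
          rw [Complex.real_smul]
          conv_lhs => rw [this]
          push_cast
          ring
        · exact i1.ofReal
        · exact (i2.ofReal (𝕜 := ℂ)).mul_const b
      rw [this, Complex.real_smul]
      push_cast; ring
  · intro hb
    rw [hval]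
    have : ∫ t in Ioi (0:ℝ), (t ^ (α - 1) : ℝ) • g t
        = ∫ t in Ioi (0:ℝ), ((t ^ (α - 1) * (1 + t)⁻¹ : ℝ) : ℂ) := by
      apply setIntegral_congr_fun measurableSet_Ioi
      intro t ht
      have h5 := hg t ht
      have ht' : 0 < t := ht
      have h6 : (1:ℂ) + t ≠ 0 := by
        exact_mod_cast (by positivity : (1 + t) ≠ 0)
      have h7 : g t = (1 + (t:ℂ))⁻¹ := by
        rw [hb, add_comm] at h5
        exact eq_inv_of_mul_eq_one_left h5
      simp only []
      rw [h7, Complex.real_smul]; push_cast; rfl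
    rw [this, integral_complex_ofReal, integral_base h0 h1, hc, Complex.real_smul, ← Complex.ofReal_mul]
    have := sin_pos h0 h1
    have : Real.sin (Real.pi * α) / Real.pi * (Real.pi / Real.sin (Real.pi * α)) = 1 := by
      field_simp
    rw [this]; rfl

/-- the power for exponent in `[0,1]` -/
def Pw (T : E) (α : ℝ) : E := if α = 0 then 1 else if α = 1 then T else Bal T α

lemma Pw_zero : Pw T 0 = 1 := by simp [Pw]
lemma Pw_one : Pw T 1 = T := by simp [Pw]
lemma Pw_mid {α : ℝ} (h0 : 0 < α) (h1 : α < 1) : Pw T α = Bal T α := by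
  simp [Pw, h0.ne', h1.ne]

lemma bic_Pw {S : Set E} (hT : T ∈ bic S) (α : ℝ) : Pw T α ∈ bic S := by
  unfold Pw
  split_ifs
  · exact one_mem _
  · exact hT
  · exact bic_Bal hT α

lemma Icc_cases {α : ℝ} (h : α ∈ Icc (0:ℝ) 1) : α = 0 ∨ α = 1 ∨ (0 < α ∧ α < 1) := by
  rcases h.1.eq_or_lt with h0 | h0
  · exact Or.inl h0.symm
  rcases h.2.eq_or_lt with h1 | h1
  · exact Or.inr (Or.inl h1)
  exact Or.inr (Or.inr ⟨h0, h1⟩)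

lemma coneVal_Pw (h : Sect T M) {S : Set E} (hT : T ∈ bic S) {φ : E →L[ℂ] ℂ}
    (hφ : IsChar S φ) {α : ℝ} (hα : α ∈ Icc (0:ℝ) 1) : ConeVal (φ T) (φ (Pw T α)) := by
  rcases Icc_cases hα with rfl | rfl | ⟨h0, h1⟩
  · rw [Pw_zero, hφ.one]; exact coneVal_one _
  · rw [Pw_one]; exact coneVal_self _
  · rw [Pw_mid h0 h1]; exact coneVal_Bal h hT hφ h0 h1

lemma Pw_mul (h : Sect T M) {α : ℝ} (hα : α ∈ Icc (0:ℝ) 1) : Pw T α * Pw T (1 - α) = T := by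
  rcases Icc_cases hα with rfl | rfl | ⟨h0, h1⟩
  · simp [Pw]
  · simp [Pw]
  · rw [Pw_mid h0 h1, Pw_mid (by linarith) (by linarith)]; exact Bal_mul h h0 h1

end algebra
end FracAux
end

noncomputable section
namespace FracAux
set_option linter.unusedSectionVars false
section algebra
variable {E : Type*} [NormedRing E] [NormedAlgebra ℂ E] [CompleteSpace E] {T : E} {M : ℝ}

section fam
variable {ι : Type*} [TopologicalSpace ι] [DiscreteTopology ι]
open BoundedContinuousFunction

/-- bounded family as an element of the Banach algebra of bounded functions -/
def fam (f : ι → E) (C : ℝ) (h : ∀ i, ‖f i‖ ≤ C) : ι →ᵇ E :=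
  BoundedContinuousFunction.ofNormedAddCommGroupDiscrete f C h

@[simp] lemma fam_apply (f : ι → E) (C : ℝ) (h : ∀ i, ‖f i‖ ≤ C) (i : ι) : fam f C h i = f i :=
  rfl

lemma fam_unit {V : ι →ᵇ E} (h : IsUnit V) :
    ∃ C : ℝ, 0 ≤ C ∧ ∀ i, IsUnit (V i) ∧ ‖Ring.inverse (V i)‖ ≤ C := by
  obtain ⟨u, rfl⟩ := h
  refine ⟨‖(↑u⁻¹ : ι →ᵇ E)‖, norm_nonneg _, fun i => ?_⟩
  let w : Eˣ := ⟨(u : ι →ᵇ E) i, (↑u⁻¹ : ι →ᵇ E) i, by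
    rw [← BoundedContinuousFunction.mul_apply, u.mul_inv]; rfl, by
    rw [← BoundedContinuousFunction.mul_apply, u.inv_mul]; rfl⟩
  refine ⟨w.isUnit, ?_⟩
  change ‖Ring.inverse (w : E)‖ ≤ _
  rw [Ring.inverse_unit]
  exact (↑u⁻¹ : ι →ᵇ E).norm_coe_le_norm i

lemma rsmul_apply (r : ℝ) (f : ι →ᵇ E) (i : ι) : (r • f) i = r • f i := rfl

lemma eval_integral {f : ℝ → (ι →ᵇ E)} {U : Set ℝ} (hf : IntegrableOn f U) (i : ι) :
    (∫ t in U, f t) i = ∫ t in U, f t i :=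
  ((BoundedContinuousFunction.evalCLM ℂ i).integral_comp_comm hf).symm

lemma ell_exists {b j : ℂ} (h : PosPair b j) (hb : b ≠ 0) (hj : j ≠ 0) :
    ∃ m : ℂ, 0 ≤ (b * m).re ∧ 0 ≤ (j * m).re ∧ 0 < m.re := by
  have hb' := norm_pos_iff.2 hb
  have hj' := norm_pos_iff.2 hj
  have hne := h.ne ‖j‖ ‖b‖ hj' hb'
  set n : ℂ := (‖j‖ : ℂ) * b + ‖b‖ * j with hn
  have hq : 0 < ‖n‖ ^ 2 := by positivity
  have eb : ‖b‖ ^ 2 = b.re ^ 2 + b.im ^ 2 := by rw [Complex.sq_norm, Complex.normSq_apply]; ring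
  have ej : ‖j‖ ^ 2 = j.re ^ 2 + j.im ^ 2 := by rw [Complex.sq_norm, Complex.normSq_apply]; ring
  have nre : n.re = ‖j‖ * b.re + ‖b‖ * j.re := by simp [hn]
  have nim : n.im = ‖j‖ * b.im + ‖b‖ * j.im := by simp [hn]
  set d := ‖b‖ * ‖j‖ + (b.re * j.re + b.im * j.im) with hd
  have en : ‖n‖ ^ 2 = 2 * (‖b‖ * ‖j‖) * d := by
    rw [Complex.sq_norm, Complex.normSq_apply, nre, nim, hd]
    linear_combination (-‖j‖ ^ 2) * eb + (-‖b‖ ^ 2) * ej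
  have hdpos : 0 < d := by
    rw [en] at hq
    exact (pos_iff_pos_of_mul_pos hq).1 (by positivity)
  have e1 : (b * (starRingEnd ℂ) n).re = ‖b‖ * d := by
    simp only [Complex.mul_re, Complex.conj_re, Complex.conj_im, nre, nim, hd]
    linear_combination (-‖j‖) * eb
  have e2 : (j * (starRingEnd ℂ) n).re = ‖j‖ * d := by
    simp only [Complex.mul_re, Complex.conj_re, Complex.conj_im, nre, nim, hd]
    linear_combination (-‖b‖) * ej
  refine ⟨(starRingEnd ℂ) n, ?_, ?_, ?_⟩
  · rw [e1]; positivity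
  · rw [e2]; positivity
  · have : (starRingEnd ℂ) n = b * (starRingEnd ℂ) n + j * (starRingEnd ℂ) n := by
      rw [← add_mul, h.sum, one_mul]
    rw [this, Complex.add_re, e1, e2]; positivity

lemma scal_id2 {b j h : ℂ} {s : ℝ} (hh : (s * j + b) * h = 1) :
    b * j * h = (((‖j‖ * ‖h‖) ^ 2 * s : ℝ) : ℂ) * b + (((‖b‖ * ‖h‖) ^ 2 : ℝ) : ℂ) * j := by
  have hh' : (s * (starRingEnd ℂ) j + (starRingEnd ℂ) b) * (starRingEnd ℂ) h = 1 := by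
    simpa using congrArg (starRingEnd ℂ) hh
  push_cast
  rw [mul_pow, mul_pow, ← Complex.mul_conj' b, ← Complex.mul_conj' j, ← Complex.mul_conj' h]
  linear_combination (-(b * j * h)) * hh'

variable (m : ι → ℝ) (hm : ∀ i, 0 < m i)

/-- the family `μ (μ+T)⁻¹` -/
def KK (h : Sect T M) : ι →ᵇ E :=
  fam (fun i => m i • res T (m i)) M fun i => h.bound1 (hm i)

/-- candidate inverse -/
def DD (h : Sect T M) (s : ℝ) (hs : 0 < s) : ι →ᵇ E :=
  fam (fun i => 1 + (1 - s) • (m i • res T (s * m i))) (‖(1:E)‖ + |1 - s| * (M / s)) fun i => by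
    refine (norm_add_le _ _).trans ?_
    gcongr
    rw [norm_smul, Real.norm_eq_abs]
    gcongr
    rw [norm_smul, Real.norm_of_nonneg (hm i).le]
    have := h.bound (s * m i) (mul_pos hs (hm i))
    have hmi := hm i
    calc _ ≤ m i * (M / (s * m i)) := by gcongr
      _ = _ := by field_simp

lemma res_comm (_h : Sect T M) {t : ℝ} (s : ℝ) :
    res T t * res T s = res T s * res T t :=
  bic_comm1 (bic_res _ (bic_self T) t) (bic_res _ (bic_self T) s)

lemma DD_apply (h : Sect T M) (s : ℝ) (hs : 0 < s) (i : ι) :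
    DD m hm h s hs i = (m i • (1:E) + T) * res T (s * m i) := by
  have e := h.mul_res (mul_pos hs (hm i))
  change 1 + (1 - s) • (m i • res T (s * m i)) = _
  nth_rw 1 [← e]
  simp only [add_mul, smul_mul_assoc, one_mul, mul_smul, sub_smul, one_smul]
  abel

lemma sK_apply (h : Sect T M) (s : ℝ) (i : ι) :
    (s • KK m hm h + 1 - KK m hm h) i = res T (m i) * ((s * m i) • (1:E) + T) := by
  have e := h.res_mul (hm i)
  change s • (m i • res T (m i)) + 1 - m i • res T (m i) = _
  nth_rw 1 [← e]
  simp only [mul_add, mul_smul_comm, mul_one, mul_smul]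
  abel

lemma sK_inv (h : Sect T M) (s : ℝ) (hs : 0 < s) :
    (s • KK m hm h + 1 - KK m hm h) * DD m hm h s hs = 1 ∧
    DD m hm h s hs * (s • KK m hm h + 1 - KK m hm h) = 1 := by
  constructor
  · ext i
    rw [BoundedContinuousFunction.mul_apply, sK_apply, DD_apply]
    have e : ((s * m i) • (1:E) + T) * (m i • (1:E) + T)
        = (m i • (1:E) + T) * ((s * m i) • (1:E) + T) :=
      bic_comm1 (add_mem (bic_rsmul (one_mem _) _) (bic_self T))
        (add_mem (bic_rsmul (one_mem _) _) (bic_self T))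
    calc _ = res T (m i) * (((s * m i) • (1:E) + T) * (m i • (1:E) + T)) * res T (s * m i) := by
          simp only [mul_assoc]
      _ = (res T (m i) * (m i • (1:E) + T)) * (((s * m i) • (1:E) + T) * res T (s * m i)) := by
          rw [e]; simp only [mul_assoc]
      _ = 1 := by rw [h.res_mul (hm i), h.mul_res (mul_pos hs (hm i)), one_mul]
  · ext i
    rw [BoundedContinuousFunction.mul_apply, sK_apply, DD_apply]
    calc _ = (m i • (1:E) + T) * (res T (s * m i) * res T (m i)) * ((s * m i) • (1:E) + T) := by
          simp only [mul_assoc]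
      _ = ((m i • (1:E) + T) * res T (m i)) * (res T (s * m i) * ((s * m i) • (1:E) + T)) := by
          rw [res_comm h]; simp only [mul_assoc]
      _ = 1 := by rw [h.mul_res (hm i), h.res_mul (mul_pos hs (hm i)), one_mul]

/-- integrand -/
def FF (h : Sect T M) (s : ℝ) : ι →ᵇ E :=
  (1 - KK m hm h) * KK m hm h * Ring.inverse (s • KK m hm h + 1 - KK m hm h)

lemma sK_isUnit (h : Sect T M) {s : ℝ} (hs : 0 < s) :
    IsUnit (s • KK m hm h + 1 - KK m hm h) :=
  ⟨⟨_, _, (sK_inv m hm h s hs).1, (sK_inv m hm h s hs).2⟩, rfl⟩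

lemma sK_inverse (h : Sect T M) {s : ℝ} (hs : 0 < s) :
    Ring.inverse (s • KK m hm h + 1 - KK m hm h) = DD m hm h s hs :=
  (((Ring.eq_mul_inverse_iff_mul_eq (DD m hm h s hs) 1 _ (sK_isUnit m hm h hs)).2
    ((sK_inv m hm h s hs).2)).trans (one_mul _)).symm

lemma FF_apply (h : Sect T M) {s : ℝ} (hs : 0 < s) (i : ι) :
    FF m hm h s i = T * res T (m i) * (m i • res T (s * m i)) := by
  rw [FF, sK_inverse m hm h hs, BoundedContinuousFunction.mul_apply, DD_apply]
  have e1 : ((1 - KK m hm h) * KK m hm h) i = T * res T (m i) * (m i • res T (m i)) := by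
    rw [h.T_mul_res (hm i)]; rfl
  rw [e1]
  calc _ = T * res T (m i) * (m i • ((res T (m i) * (m i • (1:E) + T)) * res T (s * m i))) := by
        simp only [mul_assoc, smul_mul_assoc]
    _ = _ := by rw [h.res_mul (hm i), one_mul]

lemma FF_bound (h : Sect T M) {s : ℝ} (hs : 0 < s) :
    ‖FF m hm h s‖ ≤ ((‖(1:E)‖ + M) * M + (‖(1:E)‖ + M) * M) * (1 + s)⁻¹ := by
  have hM := h.pos
  rw [BoundedContinuousFunction.norm_le (by positivity)]
  intro i
  rw [FF_apply m hm h hs]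
  have hmi := hm i
  apply le_of_two hs
  · have e : T * res T (m i) * (m i • res T (s * m i))
        = (T * res T (s * m i)) * (m i • res T (m i)) := by
      rw [mul_smul_comm, mul_smul_comm, mul_assoc, mul_assoc, res_comm h]
    rw [e]
    refine (norm_mul_le _ _).trans ?_
    gcongr
    · exact h.bound2 (mul_pos hs hmi)
    · exact h.bound1 hmi
  · refine (norm_mul_le _ _).trans ?_
    rw [mul_div_assoc]
    gcongr
    · exact h.bound2 hmi
    · rw [norm_smul, Real.norm_of_nonneg hmi.le]
      calc _ ≤ m i * (M / (s * m i)) := by gcongr; exact h.bound _ (mul_pos hs hmi)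
        _ = _ := by field_simp

lemma FF_cont (h : Sect T M) : ContinuousOn (FF m hm h) (Ioi 0) := by
  intro s hs
  apply ContinuousAt.continuousWithinAt
  apply ContinuousAt.mul continuousAt_const
  obtain ⟨u, hu⟩ := sK_isUnit m hm h hs
  have h1 := NormedRing.inverse_continuousAt u
  rw [hu] at h1
  apply ContinuousAt.comp (f := fun s : ℝ => s • KK m hm h + 1 - KK m hm h) h1
  fun_prop

lemma FF_int (h : Sect T M) {α : ℝ} (h0 : 0 < α) (h1 : α < 1) :
    IntegrableOn (fun s : ℝ => (s ^ (α - 1) : ℝ) • FF m hm h s) (Ioi 0) :=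
  int_of_bound h0 h1 (FF_cont m hm h) _ fun _ hs => FF_bound m hm h hs

/-- family version of `μ^(-α) K T^α` -/
def WW (h : Sect T M) (α : ℝ) : ι →ᵇ E := (Real.sin (Real.pi * α) / Real.pi) •
    ∫ s in Ioi (0 : ℝ), (s ^ (α - 1) : ℝ) • FF m hm h s

lemma WW_apply (h : Sect T M) {α : ℝ} (h0 : 0 < α) (h1 : α < 1) (i : ι) :
    WW m hm h α i = (m i ^ (-α)) • ((m i • res T (m i)) * Bal T α) := by
  have hmi := hm i
  rw [WW, rsmul_apply, eval_integral (FF_int m hm h h0 h1), Bal, mul_smul_comm, smul_comm]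
  congr 1
  have := integral_comp_mul_left_Ioi (fun t : ℝ => (t ^ (α - 1) : ℝ) • (T * res T t)) 0 hmi
  rw [mul_zero] at this
  have e : ∫ t in Ioi (0:ℝ), (t ^ (α - 1) : ℝ) • (T * res T t)
      = m i • ∫ s in Ioi (0:ℝ), ((m i * s) ^ (α - 1) : ℝ) • (T * res T (m i * s)) := by
    rw [this, smul_smul, mul_inv_cancel₀ hmi.ne', one_smul]
  rw [e]
  have hintg : IntegrableOn (fun s : ℝ => ((m i * s) ^ (α - 1) : ℝ) • (T * res T (m i * s)))
      (Ioi 0) := by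
    have := (integrableOn_Ioi_comp_mul_left_iff
      (fun t : ℝ => (t ^ (α - 1) : ℝ) • (T * res T t)) 0 hmi).2
    rw [mul_zero] at this
    exact this (Bal_int h h0 h1)
  rw [mul_smul_comm, smul_smul]
  have e2 := (ContinuousLinearMap.mul ℂ E (m i • res T (m i))).integral_comp_comm hintg
  simp only [ContinuousLinearMap.mul_apply'] at e2
  rw [← e2, ← integral_smul]
  apply setIntegral_congr_fun measurableSet_Ioi
  intro s hs
  have hs' : 0 < s := hs
  simp only []
  rw [rsmul_apply, FF_apply m hm h hs', Real.mul_rpow hmi.le hs'.le]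
  have e3 : T * res T (m i) * (m i • res T (s * m i))
      = (m i • res T (m i)) * (T * res T (m i * s)) := by
    rw [h.comm hmi, mul_comm s, mul_smul_comm, smul_mul_assoc, mul_assoc]
  rw [e3, mul_smul_comm, smul_smul]
  congr 1
  have : m i ^ (-α) * m i * m i ^ (α - 1) = 1 := by
    nth_rw 2 [← Real.rpow_one (m i)]
    rw [← Real.rpow_add hmi, ← Real.rpow_add hmi]; simp
  linear_combination (-(s ^ (α - 1))) * this

end fam
end algebra
end FracAux
end

noncomputable section
namespace FracAux
set_option linter.unusedSectionVars false
section algebra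
variable {E : Type*} [NormedRing E] [NormedAlgebra ℂ E] [CompleteSpace E] {T : E} {M : ℝ}

section fam
variable {ι : Type*} [TopologicalSpace ι] [DiscreteTopology ι]
open BoundedContinuousFunction

lemma ell_exists' {b j : ℂ} (h : PosPair b j) :
    ∃ m : ℂ, 0 ≤ (b * m).re ∧ 0 ≤ (j * m).re ∧ 0 < m.re := by
  by_cases hb : b = 0
  · have := h.sum
    rw [hb, zero_add] at this
    exact ⟨1, by simp [hb, this]⟩
  by_cases hj : j = 0
  · have := h.sum
    rw [hj, add_zero] at this
    exact ⟨1, by simp [hj, this]⟩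
  exact ell_exists h hb hj

variable (m : ι → ℝ) (hm : ∀ i, 0 < m i)

lemma sK_mem (h : Sect T M) (s : ℝ) :
    s • KK m hm h + 1 - KK m hm h ∈ bic {KK m hm h} :=
  sub_mem (add_mem (bic_rsmul (bic_self _) _) (one_mem _)) (bic_self _)

lemma FF_mem (h : Sect T M) (s : ℝ) : FF m hm h s ∈ bic {KK m hm h} :=
  mul_mem (mul_mem (sub_mem (one_mem _) (bic_self _)) (bic_self _))
    (bic_inverse (sK_mem m hm h s))

lemma WW_mem (h : Sect T M) (α : ℝ) : WW m hm h α ∈ bic {KK m hm h} := by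
  apply bic_rsmul
  apply bic_integral measurableSet_Ioi
  intro t _
  exact bic_rsmul (FF_mem m hm h t) _

lemma VV_unit (h : Sect T M) {α : ℝ} (h0 : 0 < α) (h1 : α < 1) :
    IsUnit (1 + WW m hm h α + WW m hm h (1 - α)) := by
  by_contra hu
  obtain ⟨φ, hφ, hv⟩ := exists_char {KK m hm h} (by rintro x rfl y rfl; rfl) _
    (add_mem (add_mem (one_mem _) (WW_mem m hm h α)) (WW_mem m hm h (1 - α))) hu
  set j := φ (KK m hm h) with hj
  set g : ℝ → ℂ := fun s => φ (Ring.inverse (s • KK m hm h + 1 - KK m hm h)) with hg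
  have hs1 : ∀ s : ℝ, φ (s • KK m hm h + 1 - KK m hm h) = s * j + (1 - j) := by
    intro s
    rw [map_sub, map_add, ← Complex.coe_smul, map_smul, hφ.one, smul_eq_mul]
    ring
  have hgs : ∀ s : ℝ, 0 < s → (s * j + (1 - j)) * g s = 1 := by
    intro s hs
    rw [← hs1, ← hφ.mul _ (sK_mem m hm h s) _ (bic_inverse (sK_mem m hm h s)),
      Ring.mul_inverse_cancel _ (sK_isUnit m hm h hs), hφ.one]
  have hp : PosPair (1 - j) j := by
    refine ⟨by ring, fun X Y hX hY he => ?_⟩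
    have h3 := hgs (Y / X) (by positivity)
    have hX' : (X : ℂ) ≠ 0 := by exact_mod_cast hX.ne'
    have : ((Y / X : ℝ) : ℂ) * j + (1 - j) = 0 := by
      push_cast
      field_simp
      linear_combination he
    rw [this, zero_mul] at h3
    exact zero_ne_one h3
  obtain ⟨n, n1, n2, n3⟩ := ell_exists' hp
  have key : ∀ γ : ℝ, 0 < γ → γ < 1 → 0 ≤ (φ (WW m hm h γ) * n).re := by
    intro γ g0 g1
    have hc : 0 < Real.sin (Real.pi * γ) / Real.pi := div_pos (sin_pos g0 g1) Real.pi_pos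
    let L : (ι →ᵇ E) →L[ℝ] ℝ := Complex.reCLM.comp
      (((ContinuousLinearMap.mul ℝ ℂ).flip n).comp (φ.restrictScalars ℝ))
    have hL : ∀ x, L x = (φ x * n).re := fun x => rfl
    rw [← hL, WW, map_smul, ← L.integral_comp_comm (FF_int m hm h g0 g1), smul_eq_mul]
    refine mul_nonneg hc.le (setIntegral_nonneg measurableSet_Ioi fun s hs => ?_)
    have hs' : 0 < s := hs
    rw [map_smul, hL, smul_eq_mul]
    refine mul_nonneg (Real.rpow_nonneg hs'.le _) ?_
    have e1 : φ (FF m hm h s) = (1 - j) * j * g s := by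
      rw [FF, hφ.mul _ (mul_mem (sub_mem (one_mem _) (bic_self _)) (bic_self _)) _
        (bic_inverse (sK_mem m hm h s)), hφ.mul _ (sub_mem (one_mem _) (bic_self _)) _ (bic_self _),
        map_sub, hφ.one]
    rw [e1, scal_id2 (hgs s hs'), add_mul, mul_assoc, mul_assoc, Complex.add_re,
      Complex.re_ofReal_mul, Complex.re_ofReal_mul]
    positivity
  have hv' := congrArg (fun z => (z * n).re) hv
  simp only [map_add, hφ.one, add_mul, one_mul, Complex.add_re, zero_mul, Complex.zero_re] at hv'
  have k1 := key α h0 h1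
  have k2 := key (1 - α) (by linarith) (by linarith)
  linarith

end fam

/-- discrete copy of the positive reals -/
structure PosD where
  val : ℝ
  pos : 0 < val

instance : TopologicalSpace PosD := ⊥
instance : DiscreteTopology PosD := ⟨rfl⟩

lemma Sect_Bal (h : Sect T M) {α : ℝ} (h0 : 0 < α) (h1 : α < 1) :
    ∃ M', Sect (Bal T α) M' := by
  set V := 1 + WW PosD.val PosD.pos h α + WW PosD.val PosD.pos h (1 - α) with hV
  obtain ⟨C, hC0, hC⟩ := fam_unit (VV_unit PosD.val PosD.pos h h0 h1)
  rw [← hV] at hC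
  set Z := KK PosD.val PosD.pos h + WW PosD.val PosD.pos h (1 - α) with hZ
  have key : ∀ t : ℝ, 0 < t → ∃ R : E, (t • (1:E) + Bal T α) * R = 1 ∧
      R * (t • (1:E) + Bal T α) = 1 ∧ ‖R‖ ≤ (‖Z‖ * C) / t := by
    intro t ht
    set μ := t ^ (α⁻¹) with hμ
    have hμ0 : 0 < μ := Real.rpow_pos_of_pos ht _
    have hμα : μ ^ α = t := by
      rw [hμ, ← Real.rpow_mul ht.le, inv_mul_cancel₀ h0.ne', Real.rpow_one]
    let i : PosD := ⟨μ, hμ0⟩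
    set x := Bal T α with hx
    set y := Bal T (1 - α) with hy
    set K := μ • res T μ with hK
    set a := μ ^ (-α) with ha
    set a' := μ ^ (-(1 - α)) with ha'
    have Vi : V i = 1 + a • (K * x) + a' • (K * y) := by
      change 1 + WW PosD.val PosD.pos h α i + WW PosD.val PosD.pos h (1 - α) i = _
      rw [WW_apply _ _ _ h0 h1, WW_apply _ _ _ (by linarith) (by linarith)]
    have Zi : Z i = K + a' • (K * y) := by
      change KK PosD.val PosD.pos h i + WW PosD.val PosD.pos h (1 - α) i = _
      rw [WW_apply _ _ _ (by linarith) (by linarith)]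
      rfl
    have mT := bic_self T
    have mx : x ∈ bic {T} := bic_Bal mT _
    have my : y ∈ bic {T} := bic_Bal mT _
    have mK : K ∈ bic {T} := bic_rsmul (bic_res _ mT _) _
    have mV : V i ∈ bic {T} := by
      rw [Vi]
      exact add_mem (add_mem (one_mem _) (bic_rsmul (mul_mem mK mx) _)) (bic_rsmul (mul_mem mK my) _)
    have mZ : Z i ∈ bic {T} := by
      rw [Zi]
      exact add_mem mK (bic_rsmul (mul_mem mK my) _)
    have hxy : x * y = T := Bal_mul h h0 h1
    have hat : t * a = 1 := by rw [← hμα, ha, ← Real.rpow_add hμ0]; simp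
    have hta' : a' * μ = t := by
      rw [ha', ← hμα]
      nth_rw 2 [← Real.rpow_one μ]
      rw [← Real.rpow_add hμ0]; ring_nf
    have main : (t • (1:E) + x) * Z i = t • V i := by
      rw [Zi, Vi]
      have e1 : x * K = K * x := bic_comm1 mx mK
      have e2 : x * (K * y) = K * T := by rw [← mul_assoc, e1, mul_assoc, hxy]
      have e3 : K * T = μ • (1 - K) := by
        rw [hK, smul_mul_assoc, h.res_mul_T hμ0]
      clear_value K
      rw [mul_add, add_mul, add_mul, mul_smul_comm a' x, e2, e3, e1]
      simp only [smul_mul_assoc, one_mul, smul_add, smul_smul, smul_sub, hta', hat, one_smul]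
      abel
    have hu := (hC i).1
    have mI : Ring.inverse (V i) ∈ bic {T} := bic_inverse mV
    have main2 : (t • (1:E) + x) * (t⁻¹ • (Z i * Ring.inverse (V i))) = 1 := by
      rw [mul_smul_comm, ← mul_assoc, main, smul_mul_assoc, Ring.mul_inverse_cancel _ hu, smul_smul,
        inv_mul_cancel₀ ht.ne', one_smul]
    refine ⟨t⁻¹ • (Z i * Ring.inverse (V i)), main2, ?_, ?_⟩
    · rw [bic_comm1 (bic_rsmul (mul_mem mZ mI) _)
        (add_mem (bic_rsmul (one_mem _) _) mx), main2]
    · rw [norm_smul, norm_inv, Real.norm_of_nonneg ht.le, div_eq_inv_mul]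
      gcongr
      refine (norm_mul_le _ _).trans ?_
      gcongr
      · exact Z.norm_coe_le_norm i
      · exact (hC i).2
  refine ⟨‖Z‖ * C, by positivity, fun t ht => ?_, fun t ht => ?_⟩
  · obtain ⟨R, r1, r2, -⟩ := key t ht
    exact ⟨⟨_, R, r1, r2⟩, rfl⟩
  · obtain ⟨R, r1, r2, r3⟩ := key t ht
    have : res (Bal T α) t = R := by
      let u : Eˣ := ⟨_, R, r1, r2⟩
      change Ring.inverse (u : E) = R
      rw [Ring.inverse_unit]
      rfl
    rwa [this]

lemma Sect_one : Sect (1:E) ‖(1:E)‖ := by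
  have key : ∀ t : ℝ, 0 < t → (t • (1:E) + 1) * ((1 + t)⁻¹ • (1:E)) = 1 ∧
      ((1 + t)⁻¹ • (1:E)) * (t • (1:E) + 1) = 1 := by
    intro t ht
    have e : t • (1:E) + 1 = (1 + t) • (1:E) := by rw [add_smul, one_smul, add_comm]
    have : (1 + t) ≠ 0 := by positivity
    rw [e]
    constructor <;> simp [smul_smul, this]
  refine ⟨norm_nonneg _, fun t ht => ⟨⟨_, _, (key t ht).1, (key t ht).2⟩, rfl⟩, fun t ht => ?_⟩
  have : res (1:E) t = (1 + t)⁻¹ • (1:E) := by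
    let u : Eˣ := ⟨_, _, (key t ht).1, (key t ht).2⟩
    change Ring.inverse (u : E) = _
    rw [Ring.inverse_unit]
    rfl
  rw [this, norm_smul, Real.norm_of_nonneg (by positivity), div_eq_inv_mul]
  gcongr
  linarith

lemma Sect_Pw (h : Sect T M) {α : ℝ} (hα : α ∈ Icc (0:ℝ) 1) : ∃ M', Sect (Pw T α) M' := by
  rcases Icc_cases hα with rfl | rfl | ⟨h0, h1⟩
  · rw [Pw_zero]; exact ⟨_, Sect_one⟩
  · rw [Pw_one]; exact ⟨_, h⟩
  · rw [Pw_mid h0 h1]; exact Sect_Bal h h0 h1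

end algebra
end FracAux
end

noncomputable section
namespace FracAux
set_option linter.unusedSectionVars false
section algebra
variable {E : Type*} [NormedRing E] [NormedAlgebra ℂ E] [CompleteSpace E] {T : E} {M : ℝ}

/-- abstract situation: `B = A(1+A)⁻¹`, `J = (1+A)⁻¹` -/
structure SPair (B J : E) (M N : ℝ) : Prop where
  sum : B + J = 1
  unit : ∀ s : ℝ, 0 < s → IsUnit (s • J + B)
  sB : Sect B M
  sJ : Sect J N

lemma SPair.symm {B J : E} {M N : ℝ} (h : SPair B J M N) : SPair J B N M := by
  refine ⟨by rw [add_comm]; exact h.sum, fun s hs => ?_, h.sJ, h.sB⟩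
  have h1 := h.unit s⁻¹ (inv_pos.2 hs)
  have : s • B + J = s • (s⁻¹ • J + B) := by
    rw [smul_add, smul_smul, mul_inv_cancel₀ hs.ne', one_smul, add_comm]
  rw [this]
  exact h1.smul (Units.mk0 s hs.ne')

section fam
variable {ι : Type*} [TopologicalSpace ι] [DiscreteTopology ι]
open BoundedContinuousFunction

lemma fam_bic {B : E} {f : ι →ᵇ E} (h : ∀ i, f i ∈ bic {B}) : f ∈ bic {const ι B} := by
  rw [mem_bic]
  intro g hg
  have hg' := hg _ rfl
  ext i
  rw [BoundedContinuousFunction.mul_apply, BoundedContinuousFunction.mul_apply]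
  apply mem_bic.1 (h i)
  rintro _ rfl
  have := congrArg (fun f => f i) hg'
  simpa using this

variable (ι) in
/-- constants as a continuous linear map -/
def cst : E →L[ℂ] (ι →ᵇ E) :=
  LinearMap.mkContinuous ⟨⟨fun x => const ι x, fun _ _ => rfl⟩, fun _ _ => rfl⟩ 1 fun x => by
    rw [one_mul]; exact norm_const_le x

lemma cst_apply (x : E) (i : ι) : cst ι x i = x := rfl

variable {B J : E} {N : ℝ}

lemma char_cst {φ : (ι →ᵇ E) →L[ℂ] ℂ} (hφ : IsChar {const ι B} φ) :
    IsChar {B} (φ.comp (cst ι)) := by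
  refine ⟨hφ.one, fun x hx y hy => ?_⟩
  exact hφ.mul (cst ι x) (fam_bic fun _ => hx) (cst ι y) (fam_bic fun _ => hy)

lemma SPair.mem_J (h : SPair B J M N) : J ∈ bic {B} := by
  rw [eq_sub_of_add_eq' h.sum]
  exact sub_mem (one_mem _) (bic_self B)

lemma SPair.posPair (h : SPair B J M N) {ψ : E →L[ℂ] ℂ} (hψ : IsChar {B} ψ) :
    PosPair (ψ B) (ψ J) := by
  refine ⟨by rw [← map_add, h.sum, hψ.one], fun X Y hX hY he => ?_⟩
  have hu := h.unit (Y / X) (by positivity)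
  have hX' : (X : ℂ) ≠ 0 := by exact_mod_cast hX.ne'
  have hm : (Y / X) • J + B ∈ bic {B} := add_mem (bic_rsmul h.mem_J _) (bic_self B)
  have h1 := hψ.mul _ hm _ (bic_inverse hm)
  rw [Ring.mul_inverse_cancel _ hu, hψ.one, map_add, ← Complex.coe_smul, map_smul, smul_eq_mul]
    at h1
  have : ((Y / X : ℝ) : ℂ) * ψ J + ψ B = 0 := by
    push_cast
    field_simp
    linear_combination he
  rw [this, zero_mul] at h1
  exact one_ne_zero h1

variable (m : ι → ℝ) (hm : ∀ i, 0 < m i) (hm1 : ∀ i, m i ≤ 1)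

/-- scalar family -/
def LL : ι →ᵇ E := fam (fun i => m i • (1:E)) ‖(1:E)‖ fun i => by
  rw [norm_smul, Real.norm_of_nonneg (hm i).le]
  exact mul_le_of_le_one_left (norm_nonneg _) (hm1 i)

lemma LL_real {φ : (ι →ᵇ E) →L[ℂ] ℂ} (hφ : IsChar {const ι B} φ) :
    ∃ l : ℝ, 0 ≤ l ∧ φ (LL m hm hm1) = l := by
  set z := φ (LL m hm hm1) with hz
  have key : ∀ d : ℝ, 0 < d → (∀ i, d ≤ ‖(m i : ℂ) - z‖) → False := by
    intro d hd h
    let I : ι →ᵇ E := fam (fun i => ((m i : ℂ) - z)⁻¹ • (1:E)) (d⁻¹ * ‖(1:E)‖) fun i => by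
      rw [norm_smul, norm_inv]
      gcongr
      exact h i
    have mI : I ∈ bic {const ι B} := fam_bic fun i => Subalgebra.smul_mem _ (one_mem _) _
    have mL : LL m hm hm1 - z • (1 : ι →ᵇ E) ∈ bic {const ι B} := by
      refine sub_mem (fam_bic fun i => bic_rsmul (one_mem _) _) ?_
      exact Subalgebra.smul_mem _ (one_mem _) _
    have e : (LL m hm hm1 - z • (1 : ι →ᵇ E)) * I = 1 := by
      ext i
      change (m i • (1:E) - z • (1:E)) * (((m i : ℂ) - z)⁻¹ • (1:E)) = 1
      have h0 : (m i : ℂ) - z ≠ 0 := norm_pos_iff.1 (hd.trans_le (h i))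
      rw [← Complex.coe_smul, ← sub_smul, smul_mul_smul_comm, mul_inv_cancel₀ h0, one_mul, one_smul]
    have := hφ.mul _ mL _ mI
    rw [e, hφ.one, map_sub, hφ.algebraMap_re, ← hz, sub_self, zero_mul] at this
    exact one_ne_zero this
  have him : z.im = 0 := by
    by_contra him
    refine key |z.im| (abs_pos.2 him) fun i => ?_
    have := Complex.abs_im_le_norm ((m i : ℂ) - z)
    simpa using this
  have hre : 0 ≤ z.re := by
    by_contra hre
    push Not at hre
    refine key (-z.re) (by linarith) fun i => ?_
    have := Complex.re_le_norm ((m i : ℂ) - z)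
    simp at this
    have := hm i
    linarith
  exact ⟨z.re, hre, by apply Complex.ext <;> simp [him]⟩

variable {α γ : ℝ} {Mx My : ℝ}

lemma KK_mem {x : E} (hx : x ∈ bic {B}) (h : Sect x Mx) : KK m hm h ∈ bic {const ι B} :=
  fam_bic fun i => bic_rsmul (bic_res _ hx _) _

lemma KK_eq {x : E} (h : Sect x Mx) : KK m hm h * (LL m hm hm1 + cst ι x) = LL m hm hm1 := by
  ext i
  change (m i • res x (m i)) * (m i • 1 + x) = m i • (1:E)
  rw [smul_mul_assoc, h.res_mul (hm i)]

lemma KK_char {x : E} (hx : x ∈ bic {B}) (h : Sect x Mx) {φ : (ι →ᵇ E) →L[ℂ] ℂ}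
    (hφ : IsChar {const ι B} φ) {l : ℝ} (hl : φ (LL m hm hm1) = l) :
    φ (KK m hm h) * (l + φ (cst ι x)) = l := by
  have := hφ.mul (KK m hm h) (KK_mem m hm hx h) (LL m hm hm1 + cst ι x)
    (add_mem (fam_bic fun i => bic_rsmul (one_mem _) _) (fam_bic fun i => hx))
  rw [KK_eq, map_add, hl] at this
  exact this.symm

lemma unit_of_char {v : ι →ᵇ E} (hv : v ∈ bic {const ι B})
    (h : ∀ φ : (ι →ᵇ E) →L[ℂ] ℂ, IsChar {const ι B} φ → φ v ≠ 0) : IsUnit v := by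
  by_contra hu
  obtain ⟨φ, hφ, h0⟩ := exists_char {const ι B} (by rintro x rfl y rfl; rfl) v hv hu
  exact h φ hφ h0

lemma V1_unit (hm1 : ∀ i, m i ≤ 1) (h : SPair B J M N) (hα : α ∈ Icc (0:ℝ) 1) (hγ : γ ∈ Icc (0:ℝ) 1)
    (hx : Sect (Pw B α) Mx) : IsUnit (KK m hm hx * cst ι (Pw J γ) + 1 - KK m hm hx) := by
  have mx : Pw B α ∈ bic {B} := bic_Pw (bic_self B) α
  have my : Pw J γ ∈ bic {B} := bic_Pw h.mem_J γ
  have mp := KK_mem (ι := ι) m hm mx hx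
  have mcy : cst ι (Pw J γ) ∈ bic {const ι B} := fam_bic fun i => my
  apply unit_of_char (sub_mem (add_mem (mul_mem mp mcy) (one_mem _)) mp)
  intro φ hφ
  have hψ := char_cst hφ
  obtain ⟨l, hl0, hl⟩ := LL_real m hm hm1 hφ
  rw [map_sub, map_add, hφ.mul _ mp _ mcy, hφ.one]
  exact N1 (h.posPair hψ) (coneVal_Pw h.sB (bic_self B) hψ hα) (coneVal_Pw h.sJ h.mem_J hψ hγ)
    l hl0 (KK_char m hm hm1 mx hx hφ hl)

lemma V2_unit (hm1 : ∀ i, m i ≤ 1) (h : SPair B J M N) (hα : α ∈ Icc (0:ℝ) 1) (hγ : γ ∈ Icc (0:ℝ) 1)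
    (hx : Sect (Pw B α) Mx) (hy : Sect (Pw J γ) My) :
    IsUnit (KK m hm hx + KK m hm hy + (1 - KK m hm hx) * cst ι (Pw J γ)
      + (1 - KK m hm hy) * cst ι (Pw B α)) := by
  have mx : Pw B α ∈ bic {B} := bic_Pw (bic_self B) α
  have my : Pw J γ ∈ bic {B} := bic_Pw h.mem_J γ
  have mp := KK_mem (ι := ι) m hm mx hx
  have mq := KK_mem (ι := ι) m hm my hy
  have mcy : cst ι (Pw J γ) ∈ bic {const ι B} := fam_bic fun i => my
  have mcx : cst ι (Pw B α) ∈ bic {const ι B} := fam_bic fun i => mx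
  apply unit_of_char (add_mem (add_mem (add_mem mp mq) (mul_mem (sub_mem (one_mem _) mp) mcy))
    (mul_mem (sub_mem (one_mem _) mq) mcx))
  intro φ hφ
  have hψ := char_cst hφ
  obtain ⟨l, hl0, hl⟩ := LL_real m hm hm1 hφ
  rw [map_add, map_add, map_add, hφ.mul _ (sub_mem (one_mem _) mp) _ mcy,
    hφ.mul _ (sub_mem (one_mem _) mq) _ mcx, map_sub, map_sub, hφ.one]
  exact N2 (h.posPair hψ) (coneVal_Pw h.sB (bic_self B) hψ hα) (coneVal_Pw h.sJ h.mem_J hψ hγ)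
    l hl0 (KK_char m hm hm1 mx hx hφ hl) (KK_char m hm hm1 my hy hφ hl)

lemma V3_unit (h : SPair B J M N) (hα : α ∈ Icc (0:ℝ) 1) (hγ : γ ∈ Icc (0:ℝ) 1) :
    IsUnit (1 + LL m hm hm1 * (cst ι (Pw B α) * cst ι (Pw J γ))) := by
  have mx : Pw B α ∈ bic {B} := bic_Pw (bic_self B) α
  have my : Pw J γ ∈ bic {B} := bic_Pw h.mem_J γ
  have mcy : cst ι (Pw J γ) ∈ bic {const ι B} := fam_bic fun i => my
  have mcx : cst ι (Pw B α) ∈ bic {const ι B} := fam_bic fun i => mx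
  have ml : LL m hm hm1 ∈ bic {const ι B} := fam_bic fun i => bic_rsmul (one_mem _) _
  apply unit_of_char (add_mem (one_mem _) (mul_mem ml (mul_mem mcx mcy)))
  intro φ hφ
  have hψ := char_cst hφ
  obtain ⟨l, hl0, hl⟩ := LL_real m hm hm1 hφ
  rw [map_add, hφ.mul _ ml _ (mul_mem mcx mcy), hφ.mul _ mcx _ mcy, hφ.one, hl]
  exact N3 (h.posPair hψ) (coneVal_Pw h.sB (bic_self B) hψ hα) (coneVal_Pw h.sJ h.mem_J hψ hγ)
    l hl0

end fam

/-- discrete copy of `(0,1]` -/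
structure UD where
  val : ℝ
  pos : 0 < val
  le : val ≤ 1

instance : TopologicalSpace UD := ⊥
instance : DiscreteTopology UD := ⟨rfl⟩

variable {B J : E} {N α γ Mx My : ℝ}

lemma V1_bound (h : SPair B J M N) (hα : α ∈ Icc (0:ℝ) 1) (hγ : γ ∈ Icc (0:ℝ) 1)
    (hx : Sect (Pw B α) Mx) : ∃ C : ℝ, 0 ≤ C ∧ ∀ t : ℝ, 0 < t → t ≤ 1 →
    IsUnit ((t • res (Pw B α) t) * Pw J γ + 1 - t • res (Pw B α) t) ∧
    ‖Ring.inverse ((t • res (Pw B α) t) * Pw J γ + 1 - t • res (Pw B α) t)‖ ≤ C := by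
  obtain ⟨C, hC0, hC⟩ := fam_unit (V1_unit UD.val UD.pos UD.le h hα hγ hx)
  exact ⟨C, hC0, fun t h0 h1 => hC ⟨t, h0, h1⟩⟩

lemma V2_bound (h : SPair B J M N) (hα : α ∈ Icc (0:ℝ) 1) (hγ : γ ∈ Icc (0:ℝ) 1)
    (hx : Sect (Pw B α) Mx) (hy : Sect (Pw J γ) My) :
    ∃ C : ℝ, 0 ≤ C ∧ ∀ t : ℝ, 0 < t → t ≤ 1 →
    IsUnit (t • res (Pw B α) t + t • res (Pw J γ) t + (1 - t • res (Pw B α) t) * Pw J γ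
      + (1 - t • res (Pw J γ) t) * Pw B α) ∧
    ‖Ring.inverse (t • res (Pw B α) t + t • res (Pw J γ) t + (1 - t • res (Pw B α) t) * Pw J γ
      + (1 - t • res (Pw J γ) t) * Pw B α)‖ ≤ C := by
  obtain ⟨C, hC0, hC⟩ := fam_unit (V2_unit UD.val UD.pos UD.le h hα hγ hx hy)
  exact ⟨C, hC0, fun t h0 h1 => hC ⟨t, h0, h1⟩⟩

lemma V3_bound (h : SPair B J M N) (hα : α ∈ Icc (0:ℝ) 1) (hγ : γ ∈ Icc (0:ℝ) 1) :
    ∃ C : ℝ, 0 ≤ C ∧ ∀ t : ℝ, 0 < t → t ≤ 1 →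
    IsUnit (1 + (t • (1:E)) * (Pw B α * Pw J γ)) ∧
    ‖Ring.inverse (1 + (t • (1:E)) * (Pw B α * Pw J γ))‖ ≤ C := by
  obtain ⟨C, hC0, hC⟩ := fam_unit (V3_unit UD.val UD.pos UD.le h hα hγ)
  exact ⟨C, hC0, fun t h0 h1 => hC ⟨t, h0, h1⟩⟩

lemma finA (h : SPair B J M N) (hα : α ∈ Icc (0:ℝ) 1) (hγ : γ ∈ Icc (0:ℝ) 1) :
    ∃ C : ℝ, ∀ t : ℝ, 0 < t → ∃ R : E, (t • (1:E) + Pw B α * Pw J γ) * R = 1 ∧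
      R * (t • (1:E) + Pw B α * Pw J γ) = 1 ∧ t * ‖R‖ ≤ C := by
  obtain ⟨Mx, hx⟩ := Sect_Pw h.sB hα
  obtain ⟨My, hy⟩ := Sect_Pw h.sJ hγ
  obtain ⟨C2, c20, hC2⟩ := V2_bound h hα hγ hx hy
  obtain ⟨C3, c30, hC3⟩ := V3_bound h hα hγ
  set x := Pw B α with hxd
  set y := Pw J γ with hyd
  have mx : x ∈ bic {B} := bic_Pw (bic_self B) α
  have my : y ∈ bic {B} := bic_Pw h.mem_J γ
  have pMx := hx.pos
  have pMy := hy.pos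
  have fin : ∀ t : ℝ, ∀ R : E, R ∈ bic {B} → (t • (1:E) + x * y) * R = 1 →
      R * (t • (1:E) + x * y) = 1 := by
    intro t R hR e
    rw [bic_comm1 hR (add_mem (bic_rsmul (one_mem _) _) (mul_mem mx my)), e]
  refine ⟨(Mx + My) * C2 + C3, fun t ht => ?_⟩
  rcases le_total t 1 with h1 | h1
  · obtain ⟨u2, b2⟩ := hC2 t ht h1
    set p := t • res x t with hp
    set q := t • res y t with hq
    have mp : p ∈ bic {B} := bic_rsmul (bic_res _ mx _) _
    have mq : q ∈ bic {B} := bic_rsmul (bic_res _ my _) _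
    set V := p + q + (1 - p) * y + (1 - q) * x with hV
    have mV : V ∈ bic {B} := add_mem (add_mem (add_mem mp mq)
      (mul_mem (sub_mem (one_mem _) mp) my)) (mul_mem (sub_mem (one_mem _) mq) mx)
    have ex : t • (1 - p) = x * p := by
      rw [hp, mul_smul_comm, hx.T_mul_res ht]
    have ey : t • (1 - q) = y * q := by
      rw [hq, mul_smul_comm, hy.T_mul_res ht]
    have np : ‖p‖ ≤ Mx := hx.bound1 ht
    have nq : ‖q‖ ≤ My := hy.bound1 ht
    clear_value p q
    have main : (t • (1:E) + x * y) * (p + q) = t • V := by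
      have e1 : x * y * p = (x * p) * y := by rw [mul_assoc, bic_comm1 my mp, mul_assoc]
      have e2 : x * y * q = (y * q) * x := by
        rw [bic_comm1 mx my, mul_assoc, bic_comm1 mx mq, mul_assoc]
      rw [add_mul, mul_add (x * y), e1, e2, ← ex, ← ey, hV]
      simp only [smul_mul_assoc, smul_add, one_mul]
      abel
    have mR : t⁻¹ • ((p + q) * Ring.inverse V) ∈ bic {B} :=
      bic_rsmul (mul_mem (add_mem mp mq) (bic_inverse mV)) _
    have main2 : (t • (1:E) + x * y) * (t⁻¹ • ((p + q) * Ring.inverse V)) = 1 := by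
      rw [mul_smul_comm, ← mul_assoc, main, smul_mul_assoc, Ring.mul_inverse_cancel _ u2, smul_smul,
        inv_mul_cancel₀ ht.ne', one_smul]
    refine ⟨_, main2, fin t _ mR main2, ?_⟩
    rw [norm_smul, norm_inv, Real.norm_of_nonneg ht.le, mul_inv_cancel_left₀ ht.ne']
    calc _ ≤ ‖p + q‖ * ‖Ring.inverse V‖ := norm_mul_le _ _
      _ ≤ (Mx + My) * C2 := by
        gcongr
        exact (norm_add_le _ _).trans (add_le_add np nq)
      _ ≤ _ := by linarith
  · have hk : 0 < t⁻¹ := inv_pos.2 ht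
    obtain ⟨u3, b3⟩ := hC3 t⁻¹ hk (inv_le_one_of_one_le₀ h1)
    set V := 1 + (t⁻¹ • (1:E)) * (x * y) with hV
    have mV : V ∈ bic {B} := add_mem (one_mem _) (mul_mem (bic_rsmul (one_mem _) _) (mul_mem mx my))
    have main : t • V = t • (1:E) + x * y := by
      rw [hV, smul_mul_assoc, one_mul, smul_add, smul_smul, mul_inv_cancel₀ ht.ne', one_smul]
    have main2 : (t • (1:E) + x * y) * (t⁻¹ • Ring.inverse V) = 1 := by
      rw [← main, smul_mul_smul_comm, mul_inv_cancel₀ ht.ne', Ring.mul_inverse_cancel _ u3, one_smul]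
    refine ⟨_, main2, fin t _ (bic_rsmul (bic_inverse mV) _) main2, ?_⟩
    rw [norm_smul, norm_inv, Real.norm_of_nonneg ht.le, mul_inv_cancel_left₀ ht.ne']
    have : 0 ≤ (Mx + My) * C2 := by positivity
    linarith

lemma finB (h : SPair B J M N) (hα : α ∈ Icc (0:ℝ) 1) (hγ : γ ∈ Icc (0:ℝ) 1) :
    ∃ C : ℝ, ∀ t : ℝ, 0 < t → ∃ U : E, U ∈ bic {B} ∧ (t • Pw J γ + Pw B α) * U = 1 ∧
      t * ‖Pw J γ * U‖ ≤ C := by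
  obtain ⟨Mx, hx⟩ := Sect_Pw h.sB hα
  obtain ⟨My, hy⟩ := Sect_Pw h.sJ hγ
  obtain ⟨C1, c10, hC1⟩ := V1_bound h hα hγ hx
  obtain ⟨C2, c20, hC2⟩ := V1_bound h.symm hγ hα hy
  set x := Pw B α with hxd
  set y := Pw J γ with hyd
  have mx : x ∈ bic {B} := bic_Pw (bic_self B) α
  have my : y ∈ bic {B} := bic_Pw h.mem_J γ
  have pMx := hx.pos
  have pMy := hy.pos
  refine ⟨‖y‖ * C1 * Mx + (‖(1:E)‖ + My) * C2, fun t ht => ?_⟩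
  rcases le_total t 1 with h1 | h1
  · obtain ⟨u, b⟩ := hC1 t ht h1
    have mr : res x t ∈ bic {B} := bic_res _ mx _
    have nr := hx.bound1 ht
    set V := (t • res x t) * y + 1 - t • res x t with hV
    have mV : V ∈ bic {B} := sub_mem (add_mem (mul_mem (bic_rsmul mr _) my) (one_mem _))
      (bic_rsmul mr _)
    have main : (t • (1:E) + x) * V = t • y + x := by
      rw [hV, mul_sub, mul_add, ← mul_assoc, mul_smul_comm, hx.mul_res ht, mul_one, smul_mul_assoc,
        one_mul]
      abel
    refine ⟨Ring.inverse V * res x t, mul_mem (bic_inverse mV) mr, ?_, ?_⟩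
    · rw [← main, mul_assoc, ← mul_assoc V, Ring.mul_inverse_cancel _ u, one_mul, hx.mul_res ht]
    · have : t * ‖y * (Ring.inverse V * res x t)‖ = ‖y * Ring.inverse V * (t • res x t)‖ := by
        rw [mul_smul_comm, norm_smul, Real.norm_of_nonneg ht.le, mul_assoc]
      rw [this]
      calc _ ≤ ‖y * Ring.inverse V‖ * ‖t • res x t‖ := norm_mul_le _ _
        _ ≤ (‖y‖ * C1) * Mx := by
          gcongr
          exact (norm_mul_le _ _).trans (by gcongr)
        _ ≤ _ := by
          have : 0 ≤ (‖(1:E)‖ + My) * C2 := by positivity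
          linarith
  · have hk : 0 < t⁻¹ := inv_pos.2 ht
    obtain ⟨u, b⟩ := hC2 t⁻¹ hk (inv_le_one_of_one_le₀ h1)
    have mr : res y t⁻¹ ∈ bic {B} := bic_res _ my _
    have nr := hy.bound2 hk
    set V := (t⁻¹ • res y t⁻¹) * x + 1 - t⁻¹ • res y t⁻¹ with hV
    have mV : V ∈ bic {B} := sub_mem (add_mem (mul_mem (bic_rsmul mr _) mx) (one_mem _))
      (bic_rsmul mr _)
    have main : (t⁻¹ • (1:E) + y) * V = t⁻¹ • (t • y + x) := by
      rw [hV, mul_sub, mul_add, ← mul_assoc, mul_smul_comm, hy.mul_res hk, mul_one, smul_mul_assoc,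
        one_mul, smul_add, smul_smul, inv_mul_cancel₀ ht.ne', one_smul]
      abel
    refine ⟨t⁻¹ • (Ring.inverse V * res y t⁻¹), bic_rsmul (mul_mem (bic_inverse mV) mr) _, ?_, ?_⟩
    · rw [mul_smul_comm, ← smul_mul_assoc, ← main, mul_assoc, ← mul_assoc V,
        Ring.mul_inverse_cancel _ u, one_mul, hy.mul_res hk]
    · have : t * ‖y * (t⁻¹ • (Ring.inverse V * res y t⁻¹))‖ = ‖(y * res y t⁻¹) * Ring.inverse V‖ := by
        rw [mul_smul_comm, norm_smul, norm_inv, Real.norm_of_nonneg ht.le,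
          mul_inv_cancel_left₀ ht.ne', bic_comm1 (bic_inverse mV) mr, mul_assoc]
      rw [this]
      calc _ ≤ ‖y * res y t⁻¹‖ * ‖Ring.inverse V‖ := norm_mul_le _ _
        _ ≤ (‖(1:E)‖ + My) * C2 := by gcongr
        _ ≤ _ := by
          have : 0 ≤ ‖y‖ * C1 * Mx := by positivity
          linarith

end algebra
end FracAux
end

noncomputable section
namespace FracAux
set_option linter.unusedSectionVars false
section algebra
variable {E : Type*} [NormedRing E] [NormedAlgebra ℂ E] [CompleteSpace E]

lemma Sect_of {T : E} {M : ℝ} (hM : 0 ≤ M) (h : ∀ t : ℝ, 0 < t → ∃ R : E,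
    (t • (1:E) + T) * R = 1 ∧ R * (t • (1:E) + T) = 1 ∧ ‖R‖ ≤ M / t) : Sect T M := by
  refine ⟨hM, fun t ht => ?_, fun t ht => ?_⟩
  · obtain ⟨R, r1, r2, -⟩ := h t ht
    exact ⟨⟨_, R, r1, r2⟩, rfl⟩
  · obtain ⟨R, r1, r2, r3⟩ := h t ht
    have : res T t = R := by
      let u : Eˣ := ⟨_, R, r1, r2⟩
      change Ring.inverse (u : E) = R
      rw [Ring.inverse_unit]
      rfl
    rwa [this]

lemma SPair_of {J : E} {C : ℝ} (hC : 0 ≤ C) (h : ∀ s : ℝ, 0 < s → ∃ R : E,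
    J + (1 - s) • (J * R) = R ∧ R + (s - 1) • (R * J) = J ∧ s * ‖R‖ ≤ C) :
    SPair (1 - J) J (‖(1:E)‖ + C) (‖(1:E)‖ + C) := by
  have inv : ∀ s : ℝ, ∀ R : E, J + (1 - s) • (J * R) = R → R + (s - 1) • (R * J) = J →
      (s • J + (1 - J)) * (1 + (1 - s) • R) = 1 ∧ (1 + (1 - s) • R) * (s • J + (1 - J)) = 1 := by
    intro s R e1 e2
    have e0 : s • J + (1 - J) = 1 + (s - 1) • J := by rw [sub_smul, one_smul]; abel
    rw [e0]
    have f1 : (1 - s) • R = (1 - s) • J + ((1 - s) * (1 - s)) • (J * R) := by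
      rw [mul_smul, ← smul_add, e1]
    have f2 : (1 - s) • J = (1 - s) • R + ((1 - s) * (s - 1)) • (R * J) := by
      rw [mul_smul, ← smul_add, e2]
    have g : s - 1 = -(1 - s) := by ring
    constructor
    · simp only [add_mul, mul_add, one_mul, mul_one, smul_mul_smul_comm]
      rw [g, neg_mul, neg_smul, neg_smul, f1]
      abel
    · simp only [add_mul, mul_add, one_mul, mul_one, smul_mul_smul_comm]
      rw [g] at f2 ⊢
      rw [neg_smul, f2]
      abel
  refine ⟨sub_add_cancel _ _, fun s hs => ?_, Sect_of (by positivity) fun t ht => ?_,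
    Sect_of (by positivity) fun t ht => ?_⟩
  · obtain ⟨R, e1, e2, -⟩ := h s hs
    obtain ⟨i1, i2⟩ := inv s R e1 e2
    exact ⟨⟨_, _, i1, i2⟩, rfl⟩
  · have h1 : 0 < 1 + t := by positivity
    obtain ⟨R, e1, e2, e3⟩ := h (t / (1 + t)) (by positivity)
    obtain ⟨i1, i2⟩ := inv _ R e1 e2
    have e : t • (1:E) + (1 - J) = (1 + t) • ((t / (1 + t)) • J + (1 - J)) := by
      rw [smul_add, smul_smul, mul_div_cancel₀ _ h1.ne', smul_sub, add_smul, add_smul, one_smul,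
        one_smul]
      abel
    refine ⟨(1 + t)⁻¹ • (1 + (1 - t / (1 + t)) • R), ?_, ?_, ?_⟩
    · rw [e, smul_mul_smul_comm, i1, mul_inv_cancel₀ h1.ne', one_smul]
    · rw [e, smul_mul_smul_comm, i2, inv_mul_cancel₀ h1.ne', one_smul]
    · have e4 : 1 - t / (1 + t) = (1 + t)⁻¹ := by field_simp; ring
      rw [e4, norm_smul, Real.norm_of_nonneg (by positivity)]
      have e5 : ‖R‖ ≤ C * (1 + t) / t := by
        rw [le_div_iff₀ ht]
        rw [div_mul_eq_mul_div, div_le_iff₀ h1] at e3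
        linarith
      calc _ ≤ (1 + t)⁻¹ * (‖(1:E)‖ + (1 + t)⁻¹ * (C * (1 + t) / t)) := by
            gcongr
            refine (norm_add_le _ _).trans ?_
            gcongr
            rw [norm_smul, Real.norm_of_nonneg (by positivity)]
            gcongr
        _ = (‖(1:E)‖ * (t / (1 + t)) + C * (1 / (1 + t))) / t := by field_simp
        _ ≤ (‖(1:E)‖ * 1 + C * 1) / t := by
            gcongr
            · rw [div_le_one h1]; linarith
            · rw [div_le_one h1]; linarith
        _ = _ := by simp
  · have h1 : 0 < 1 + t := by positivity
    obtain ⟨R, e1, e2, e3⟩ := h ((1 + t) / t) (by positivity)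
    obtain ⟨i1, i2⟩ := inv _ R e1 e2
    have e : t • (1:E) + J = t • (((1 + t) / t) • J + (1 - J)) := by
      rw [smul_add, smul_smul, mul_div_cancel₀ _ ht.ne', smul_sub, add_smul, one_smul]
      abel
    refine ⟨t⁻¹ • (1 + (1 - (1 + t) / t) • R), ?_, ?_, ?_⟩
    · rw [e, smul_mul_smul_comm, i1, mul_inv_cancel₀ ht.ne', one_smul]
    · rw [e, smul_mul_smul_comm, i2, inv_mul_cancel₀ ht.ne', one_smul]
    · have e4 : 1 - (1 + t) / t = -t⁻¹ := by field_simp; ring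
      rw [e4, norm_smul, Real.norm_of_nonneg (by positivity), div_eq_inv_mul]
      have e5 : t⁻¹ * ‖R‖ ≤ C := by
        refine le_trans ?_ e3
        gcongr
        rw [inv_eq_one_div]
        gcongr
        linarith
      gcongr
      refine (norm_add_le _ _).trans ?_
      gcongr
      rw [norm_smul, norm_neg, Real.norm_of_nonneg (by positivity)]
      exact e5
end algebra

variable {X : Type*} [NormedAddCommGroup X] [NormedSpace ℂ X] [CompleteSpace X]

lemma balakrishnan_eq (T : X →L[ℂ] X) (a : ℝ) : balakrishnan T a = Bal T a := rfl

lemma opPow_eq (T : X →L[ℂ] X) {a : ℝ} (ha : a ∈ Icc (0:ℝ) 1) : opPow T a = Pw T a := by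
  rcases Icc_cases ha with rfl | rfl | ⟨h0, h1⟩
  · simp [opPow, Pw]
  · simp [opPow, Pw]
  · have hf : ⌊a⌋₊ = 0 := Nat.floor_eq_zero.2 h1
    rw [Pw_mid h0 h1, opPow, hf]
    simp [h0.ne', balakrishnan_eq]

lemma SPair_of_sectorial {A : X →ₗ.[ℂ] X} (hsec : IsSectorialOp A)
    {J : X →L[ℂ] X} (hJ : IsResolvent A 1 J) : ∃ M N, SPair (1 - J) J M N := by
  obtain ⟨-, C, hC⟩ := hsec
  have hC0 : 0 ≤ C := by
    obtain ⟨R, -, h⟩ := hC 1 one_pos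
    exact le_trans (by positivity) h
  refine ⟨_, _, SPair_of hC0 fun s hs => ?_⟩
  obtain ⟨R, hR, hb⟩ := hC s hs
  refine ⟨R, ?_, ?_, hb⟩
  · ext x
    have h1 := hJ.left_inv ⟨R x, hR.mem_domain x⟩
    have h2 := eq_sub_of_add_eq' (hR.eq_apply x)
    rw [h2] at h1
    simp only [map_add, map_sub, map_smul, one_smul] at h1
    simp only [Complex.coe_smul] at h1
    change J x + (1 - s) • J (R x) = R x
    rw [sub_smul, one_smul]
    refine Eq.trans ?_ h1
    abel
  · ext x
    have h1 := hR.left_inv ⟨J x, hJ.mem_domain x⟩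
    have h2 := eq_sub_of_add_eq' (hJ.eq_apply x)
    rw [h2] at h1
    simp only [map_add, map_sub, map_smul, one_smul] at h1
    simp only [Complex.coe_smul] at h1
    change R x + (s - 1) • R (J x) = J x
    rw [sub_smul, one_smul]
    refine Eq.trans ?_ h1
    abel

end FracAux
end

open FracAux

/-- Let `A` be a sectorial operator on a complex Banach space `X` and
`α, β ∈ [0,1]`.  Then
(i) `ran(A^α (I+A)^{-(α+β)}) = ran(A^α) ∩ dom(A^β)`, where
`A^α(I+A)^{-(α+β)} = B(A)^α J^β`, `ran(A^α) = ran(B(A)^α)` and `dom(A^β) = ran(J^β)`;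
(ii) the operator `A^α (I+A)^{-β}` (described by its graph) is sectorial, i.e. it is
densely defined and `(lam + A^α(I+A)^{-β})⁻¹` exists for all `lam > 0` with
`sup_{lam>0} ‖lam (lam + A^α(I+A)^{-β})⁻¹‖ < ∞`. -/
theorem fractional_power_range_and_sectoriality
    {X : Type*} [NormedAddCommGroup X] [NormedSpace ℂ X] [CompleteSpace X]
    (A : X →ₗ.[ℂ] X) (hsec : IsSectorialOp A)
    (J : X →L[ℂ] X) (hJ : IsResolvent A 1 J)
    (α β : ℝ) (hα : α ∈ Set.Icc (0 : ℝ) 1) (hβ : β ∈ Set.Icc (0 : ℝ) 1) :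
    (Set.range ⇑(opPow ((1 : X →L[ℂ] X) - J) α * opPow J β) =
      Set.range ⇑(opPow ((1 : X →L[ℂ] X) - J) α) ∩ Set.range ⇑(opPow J β)) ∧
    (Dense {x : X | ∃ y : X, fracPowerGraph J α β x y} ∧
      ∃ C : ℝ, ∀ lam : ℝ, 0 < lam →
        ∃ R : X →L[ℂ] X,
          (∀ x : X, fracPowerGraph J α β (R x) (x - lam • R x)) ∧
          (∀ x y : X, fracPowerGraph J α β x y → R (lam • x + y) = x) ∧
          lam * ‖R‖ ≤ C) := by
  obtain ⟨M, N, h⟩ := SPair_of_sectorial hsec hJ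
  have mB := bic_self (1 - J)
  have mJ := h.mem_J
  have mb : ∀ a, Pw (1 - J) a ∈ bic {1 - J} := bic_Pw mB
  have mj : ∀ a, Pw J a ∈ bic {1 - J} := bic_Pw mJ
  have capp : ∀ {P Q : X →L[ℂ] X}, P ∈ bic {1 - J} → Q ∈ bic {1 - J} → ∀ x, P (Q x) = Q (P x) :=
    fun hP hQ x => congrArg (fun f : X →L[ℂ] X => f x) (bic_comm1 hP hQ)
  refine ⟨?_, ?_⟩
  · rw [opPow_eq _ hα, opPow_eq _ hβ]
    have eB : ∀ x, Pw (1 - J) α (Pw (1 - J) (1 - α) x) = x - J x := fun x =>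
      congrArg (fun f : X →L[ℂ] X => f x) (Pw_mul h.sB hα)
    have eJ : ∀ x, Pw J β (Pw J (1 - β) x) = J x := fun x =>
      congrArg (fun f : X →L[ℂ] X => f x) (Pw_mul h.sJ hβ)
    apply Set.Subset.antisymm
    · rintro _ ⟨x, rfl⟩
      exact ⟨⟨Pw J β x, rfl⟩, ⟨Pw (1 - J) α x, capp (mj _) (mb _) x⟩⟩
    · rintro x ⟨⟨y, hy⟩, ⟨z, hz⟩⟩
      refine ⟨Pw J (1 - β) y + Pw (1 - J) (1 - α) z, ?_⟩
      change Pw (1 - J) α (Pw J β (Pw J (1 - β) y + Pw (1 - J) (1 - α) z)) = x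
      rw [map_add, map_add, eJ, capp (mb α) mJ, hy, capp (mj β) (mb _), hz, eB]
      abel
  by_cases hab : α ≤ β
  · have hγ : β - α ∈ Icc (0:ℝ) 1 := ⟨by linarith, by linarith [hβ.2, hα.1]⟩
    have hg : ∀ x y, fracPowerGraph J α β x y ↔ y = (Pw (1 - J) α * Pw J (β - α)) x := by
      intro x y
      rw [fracPowerGraph, if_pos hab, opPow_eq _ hα, opPow_eq _ hγ]
    simp only [hg]
    refine ⟨by simp, ?_⟩
    obtain ⟨C, hC⟩ := finA h hα hγ
    refine ⟨C, fun t ht => ?_⟩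
    obtain ⟨R, r1, r2, r3⟩ := hC t ht
    refine ⟨R, fun x => ?_, fun x y hxy => ?_, r3⟩
    · have : t • R x + (Pw (1 - J) α * Pw J (β - α)) (R x) = x :=
        congrArg (fun f : X →L[ℂ] X => f x) r1
      exact (eq_sub_of_add_eq' this).symm
    · rw [hxy]
      exact congrArg (fun f : X →L[ℂ] X => f x) r2
  · have hab' : β < α := not_le.1 hab
    have hγ : α - β ∈ Icc (0:ℝ) 1 := ⟨by linarith, by linarith [hα.2, hβ.1]⟩
    have hg : ∀ x y, fracPowerGraph J α β x y ↔ Pw J (α - β) y = Pw (1 - J) α x := by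
      intro x y
      rw [fracPowerGraph, if_neg hab, opPow_eq _ hα, opPow_eq _ hγ]
    simp only [hg]
    constructor
    · refine hsec.1.mono fun x hx => ?_
      have hz := hJ.left_inv ⟨x, hx⟩
      set z := (1:ℂ) • x + A ⟨x, hx⟩ with hzd
      refine ⟨Pw J (1 - (α - β)) (Pw (1 - J) α z), ?_⟩
      have eJ : ∀ x, Pw J (α - β) (Pw J (1 - (α - β)) x) = J x := fun x =>
        congrArg (fun f : X →L[ℂ] X => f x) (Pw_mul h.sJ hγ)
      rw [eJ, capp mJ (mb _)]
      exact congrArg _ hz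
    · obtain ⟨C, hC⟩ := finB h hα hγ
      refine ⟨C, fun t ht => ?_⟩
      obtain ⟨U, mU, r1, r3⟩ := hC t ht
      have r1' : ∀ x, t • Pw J (α - β) (U x) + Pw (1 - J) α (U x) = x := fun x =>
        congrArg (fun f : X →L[ℂ] X => f x) r1
      refine ⟨Pw J (α - β) * U, fun x => ?_, fun x y hxy => ?_, r3⟩
      · change Pw J (α - β) (x - t • Pw J (α - β) (U x)) = Pw (1 - J) α (Pw J (α - β) (U x))
        have := eq_sub_of_add_eq' (r1' x)
        rw [← this, capp (mj _) (mb _)]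
      · change Pw J (α - β) (U (t • x + y)) = x
        have e : Pw J (α - β) (t • x + y) = t • Pw J (α - β) x + Pw (1 - J) α x := by
          rw [map_add, hxy, ← Complex.coe_smul, map_smul, Complex.coe_smul]
        rw [capp (mj _) mU, e]
        exact (capp mU (add_mem (bic_rsmul (mj (α - β)) t) (mb α)) x).trans (r1' x)
end
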